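/- Let q be a prime power and n ≥ 5. (a) If (n,q) ≠ (5,2) and {λ,μ} is a symbol of rank n and type D_n that is not one of the three symbols {(n),(0)}, {(n−1),(1)}, {(0,1),(1,n)} — whose generic degrees are respectively 1, (q^n−1)(q^{n−1}+q)/(q²−1), (q^{2n}−q²)/(q²−1) — then d(λ;μ) > q^{4n−10}. (b) If (n,q) = (5,2), the same conclusion holds except that additionally the symbol ((0,1,2,4); ) has generic degree 868, which is less than 2^{10}. Consequently, every unipotent complex character of P(CO^+_{2n}(q)^0) other than the characters labeled by the listed symbols has degree greater than q^{4n−10}. -/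

import Mathlib

/-- The exponent `N = C(a+b-2,2) + C(a+b-4,2) + ⋯` appearing in the generic degree formula. -/
def symbN (a b : ℕ) : ℕ := ∑ j ∈ Finset.range (a + b), Nat.choose (a + b - 2 * (j + 1)) 2

/-- `∏_{x < y ∈ l} (q^y - q^x)`. -/
def prodDiff (q : ℚ) (l : Finset ℕ) : ℚ :=
  ∏ x ∈ l, ∏ y ∈ l, if x < y then (q ^ y - q ^ x) else 1

/-- `∏_{x ∈ l, y ∈ m} (q^x + q^y)`. -/
def prodSum (q : ℚ) (l m : Finset ℕ) : ℚ := ∏ x ∈ l, ∏ y ∈ m, (q ^ x + q ^ y)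

/-- `∏_{x ∈ l} ∏_{k=1}^{x} (q^{2k} - 1)`. -/
def prodDen (q : ℚ) (l : Finset ℕ) : ℚ :=
  ∏ x ∈ l, ∏ k ∈ Finset.Icc 1 x, (q ^ (2 * k) - 1)

/-- `(l; m)` is a symbol of rank `n` and type `D_n`: two strictly increasing sequences of
nonnegative integers (encoded as finite sets), whose numbers `a`, `b` of entries satisfy
`a - b ≡ 0 (mod 4)`, whose first entries are not both `0`, and with
`Σ l + Σ m - ⌊((a+b-1)/2)²⌋ = n`. -/
def IsSymbolD (n : ℕ) (l m : Finset ℕ) : Prop :=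
  (4 : ℤ) ∣ ((l.card : ℤ) - (m.card : ℤ)) ∧ ¬(0 ∈ l ∧ 0 ∈ m) ∧
    l.sum id + m.sum id = (l.card + m.card - 1) ^ 2 / 4 + n

/-- The generic degree of a symbol of type `D_n`. -/
def gdegD (q : ℚ) (n : ℕ) (l m : Finset ℕ) : ℚ :=
  ((q ^ n - 1) * (∏ i ∈ Finset.Icc 1 (n - 1), (q ^ (2 * i) - 1)) * prodDiff q l * prodDiff q m *
      prodSum q l m) /
    (2 ^ (if l = m then l.card else (l.card + m.card - 2) / 2) * q ^ symbN l.card m.card *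
      prodDen q l * prodDen q m)

/-- `∏_{k=1}^{x} (q^{2k} - 1)`. -/
def evenProd (q : ℚ) (x : ℕ) : ℚ := ∏ k ∈ Finset.Icc 1 x, (q ^ (2 * k) - 1)

lemma evenProd_succ (q : ℚ) (x : ℕ) :
    evenProd q (x + 1) = evenProd q x * (q ^ (2 * (x + 1)) - 1) := by
  simp [evenProd, Finset.prod_Icc_succ_top]

lemma evenProd_zero (q : ℚ) : evenProd q 0 = 1 := by simp [evenProd]

lemma evenProd_pos {q : ℚ} (hq : 2 ≤ q) (x : ℕ) : 0 < evenProd q x := by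
  refine Finset.prod_pos fun k hk => ?_
  have hk := (Finset.mem_Icc.1 hk).1
  have : 1 < q ^ (2 * k) := one_lt_pow₀ (by linarith) (by omega)
  linarith

lemma prodDen_pos {q : ℚ} (hq : 2 ≤ q) (l : Finset ℕ) : 0 < prodDen q l :=
  Finset.prod_pos fun x _ => evenProd_pos hq x

lemma prodDen_insert (q : ℚ) {x : ℕ} {l : Finset ℕ} (hx : x ∉ l) :
    prodDen q (insert x l) = evenProd q x * prodDen q l := by
  simp [prodDen, evenProd, Finset.prod_insert hx]

lemma prodSum_pos {q : ℚ} (hq : 2 ≤ q) (l m : Finset ℕ) : 0 < prodSum q l m :=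
  Finset.prod_pos fun x _ => Finset.prod_pos fun y _ => by positivity

lemma prodSum_insert (q : ℚ) {x : ℕ} {l : Finset ℕ} (m : Finset ℕ) (hx : x ∉ l) :
    prodSum q (insert x l) m = (∏ y ∈ m, (q ^ x + q ^ y)) * prodSum q l m := by
  simp [prodSum, Finset.prod_insert hx]

lemma prodSum_comm (q : ℚ) (l m : Finset ℕ) : prodSum q l m = prodSum q m l := by
  unfold prodSum
  rw [Finset.prod_comm]
  simp only [add_comm]

lemma prodDiff_pos {q : ℚ} (hq : 2 ≤ q) (l : Finset ℕ) : 0 < prodDiff q l := by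
  refine Finset.prod_pos fun x _ => Finset.prod_pos fun y _ => ?_
  split_ifs with h
  · exact sub_pos.2 (pow_lt_pow_right₀ (by linarith) h)
  · exact one_pos

lemma prodDiff_insert {q : ℚ} (hq : 2 ≤ q) {x : ℕ} {l : Finset ℕ} (hx : x ∉ l) :
    prodDiff q (insert x l) = (∏ y ∈ l, |q ^ x - q ^ y|) * prodDiff q l := by
  unfold prodDiff
  rw [Finset.prod_insert hx, Finset.prod_insert hx]
  simp only [lt_irrefl, if_false, one_mul, Finset.prod_insert hx]
  rw [Finset.prod_mul_distrib, ← mul_assoc, ← Finset.prod_mul_distrib]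
  congr 1
  refine Finset.prod_congr rfl fun y hy => ?_
  rcases lt_trichotomy x y with h | h | h
  · have := pow_lt_pow_right₀ (show 1 < q by linarith) h
    rw [if_pos h, if_neg (by omega), abs_of_neg (by linarith)]
    ring
  · exact absurd (h ▸ hy) hx
  · have := pow_lt_pow_right₀ (show 1 < q by linarith) h
    rw [if_neg (by omega), if_pos h, abs_of_pos (by linarith)]
    ring

lemma gdegD_comm (q : ℚ) (n : ℕ) (l m : Finset ℕ) : gdegD q n l m = gdegD q n m l := by
  have hN : symbN l.card m.card = symbN m.card l.card := by
    unfold symbN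
    rw [add_comm]
  unfold gdegD
  rw [prodSum_comm q l m, hN, add_comm l.card m.card]
  by_cases h : l = m
  · subst h; ring
  · rw [if_neg h, if_neg (Ne.symm h)]
    ring

/-- The generic degree with the contribution of one entry `x` of the first row isolated. -/
lemma gdegD_insert {q : ℚ} (hq : 2 ≤ q) (n : ℕ) {x : ℕ} {l : Finset ℕ} (m : Finset ℕ)
    (hx : x ∉ l) :
    gdegD q n (insert x l) m =
      ((q ^ n - 1) * evenProd q (n - 1) * ((∏ y ∈ l, |q ^ x - q ^ y|) * prodDiff q l) *
        prodDiff q m * ((∏ y ∈ m, (q ^ x + q ^ y)) * prodSum q l m)) /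
      (2 ^ (if insert x l = m then l.card + 1 else (l.card + 1 + m.card - 2) / 2) *
        q ^ symbN (l.card + 1) m.card * (evenProd q x * prodDen q l) * prodDen q m) := by
  rw [← prodDiff_insert hq hx, ← prodSum_insert q m hx, ← prodDen_insert q hx,
    ← Finset.card_insert_of_notMem hx]
  rfl

/-! ### Invariance under the shift -/

/-- The row `{0} ∪ (l + 1)`. -/
def shiftRow (l : Finset ℕ) : Finset ℕ := insert 0 (l.map (addRightEmbedding 1))

lemma zero_notMem_map_succ (l : Finset ℕ) : 0 ∉ l.map (addRightEmbedding 1) := by simp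

lemma shiftRow_card (l : Finset ℕ) : (shiftRow l).card = l.card + 1 := by
  simp [shiftRow]

lemma shiftRow_sum (l : Finset ℕ) : (shiftRow l).sum id = l.sum id + l.card := by
  simp [shiftRow, Finset.sum_add_distrib]

lemma shiftRow_injective : Function.Injective shiftRow := by
  intro l m h
  ext x
  have := congrArg (fun s => x + 1 ∈ s) h
  simpa [shiftRow] using this

lemma exists_shiftRow {l : Finset ℕ} (h : 0 ∈ l) : ∃ l', l = shiftRow l' := by
  refine ⟨(l.erase 0).image Nat.pred, ?_⟩
  ext x
  cases x with
  | zero => simp [shiftRow, h]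
  | succ x =>
    simp only [shiftRow, Finset.mem_insert, Finset.mem_map, Finset.mem_image, Finset.mem_erase,
      addRightEmbedding_apply]
    constructor
    · intro hx
      exact Or.inr ⟨x, ⟨x + 1, ⟨by omega, hx⟩, rfl⟩, rfl⟩
    · rintro (h0 | ⟨y, ⟨z, ⟨hz, hz'⟩, rfl⟩, hy⟩)
      · omega
      · have : z = x + 1 := by
          have := Nat.succ_pred hz
          omega
        exact this ▸ hz'

lemma prodDen_shiftRow (q : ℚ) (l : Finset ℕ) :
    prodDen q (shiftRow l) = prodDen q l * ∏ y ∈ l, (q ^ (2 * (y + 1)) - 1) := by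
  rw [shiftRow, prodDen_insert q (zero_notMem_map_succ l), evenProd_zero, one_mul]
  simp only [prodDen, Finset.prod_map, addRightEmbedding_apply, ← Finset.prod_mul_distrib]
  exact Finset.prod_congr rfl fun y _ => evenProd_succ q y

lemma prodSum_shiftRow (q : ℚ) (l m : Finset ℕ) :
    prodSum q (shiftRow l) (shiftRow m) =
      2 * q ^ (l.card * m.card) * prodSum q l m * (∏ y ∈ l, (q ^ (y + 1) + 1)) *
        ∏ y ∈ m, (q ^ (y + 1) + 1) := by
  have h : prodSum q (l.map (addRightEmbedding 1)) (m.map (addRightEmbedding 1)) =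
      q ^ (l.card * m.card) * prodSum q l m := by
    simp only [prodSum, Finset.prod_map, addRightEmbedding_apply]
    rw [mul_comm l.card, pow_mul, ← Finset.prod_const, ← Finset.prod_mul_distrib]
    refine Finset.prod_congr rfl fun x _ => ?_
    rw [← Finset.prod_const, ← Finset.prod_mul_distrib]
    exact Finset.prod_congr rfl fun y _ => by ring
  rw [shiftRow, prodSum_insert q _ (zero_notMem_map_succ l), prodSum_comm q _ (shiftRow m),
    shiftRow, prodSum_insert q _ (zero_notMem_map_succ m), prodSum_comm q _ (l.map _), h,
    Finset.prod_insert (zero_notMem_map_succ m)]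
  simp only [Finset.prod_map, addRightEmbedding_apply, pow_zero, add_comm (1 : ℚ)]
  ring

lemma prodDiff_map_succ {q : ℚ} (hq : 2 ≤ q) (l : Finset ℕ) :
    prodDiff q (l.map (addRightEmbedding 1)) = q ^ (l.card.choose 2) * prodDiff q l := by
  induction l using Finset.induction_on with
  | empty => simp [prodDiff]
  | insert a s has ih =>
    have : ∏ y ∈ s.map (addRightEmbedding 1), |q ^ (addRightEmbedding 1 a) - q ^ y| =
        q ^ s.card * ∏ y ∈ s, |q ^ a - q ^ y| := by
      rw [Finset.prod_map, ← Finset.prod_const, ← Finset.prod_mul_distrib]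
      refine Finset.prod_congr rfl fun y _ => ?_
      simp only [addRightEmbedding_apply]
      rw [pow_succ', pow_succ', ← mul_sub, abs_mul, abs_of_nonneg (show 0 ≤ q by linarith)]
    rw [Finset.map_insert, prodDiff_insert hq (by simpa using has), prodDiff_insert hq has, this,
      ih, Finset.card_insert_of_notMem has, Nat.choose_succ_succ' s.card 1, Nat.choose_one_right,
      pow_add]
    ring

lemma prodDiff_shiftRow {q : ℚ} (hq : 2 ≤ q) (l : Finset ℕ) :
    prodDiff q (shiftRow l) =
      q ^ (l.card.choose 2) * prodDiff q l * ∏ y ∈ l, (q ^ (y + 1) - 1) := by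
  rw [shiftRow, prodDiff_insert hq (zero_notMem_map_succ l), prodDiff_map_succ hq, mul_comm]
  congr 1
  rw [Finset.prod_map]
  refine Finset.prod_congr rfl fun y _ => ?_
  have : 1 ≤ q ^ (y + 1) := one_le_pow₀ (by linarith)
  rw [addRightEmbedding_apply, pow_zero, abs_sub_comm, abs_of_nonneg (by linarith)]

lemma symbN_succ_succ (a b : ℕ) : symbN (a + 1) (b + 1) = (a + b).choose 2 + symbN a b := by
  unfold symbN
  rw [show a + 1 + (b + 1) = (a + b) + 1 + 1 by ring, Finset.sum_range_succ', add_comm]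
  congr 1
  rw [Finset.sum_range_succ]
  have : (a + b + 1 + 1 - 2 * (a + b + 1 + 1)).choose 2 = 0 := by
    rw [Nat.choose_eq_zero_iff]; omega
  rw [this, add_zero]
  refine Finset.sum_congr rfl fun j _ => ?_
  congr 1
  omega

lemma choose_two_add (a b : ℕ) :
    (a + b).choose 2 = a.choose 2 + b.choose 2 + a * b := by
  induction b with
  | zero => simp
  | succ b ih =>
    rw [← add_assoc, Nat.choose_succ_succ' (a + b) 1, Nat.choose_succ_succ' b 1, ih]
    simp only [Nat.choose_one_right]
    ring

lemma gdegD_shiftRow {q : ℚ} (hq : 2 ≤ q) (n : ℕ) (l m : Finset ℕ) (hlm : 1 ≤ l.card + m.card)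
    (heven : Even (l.card + m.card)) :
    gdegD q n (shiftRow l) (shiftRow m) = gdegD q n l m := by
  have hfac : ∀ s : Finset ℕ, ∏ y ∈ s, (q ^ (2 * (y + 1)) - 1) =
      (∏ y ∈ s, (q ^ (y + 1) - 1)) * ∏ y ∈ s, (q ^ (y + 1) + 1) := by
    intro s
    rw [← Finset.prod_mul_distrib]
    exact Finset.prod_congr rfl fun y _ => by ring
  have hpos1 : ∀ s : Finset ℕ, (∏ y ∈ s, (q ^ (y + 1) - 1)) ≠ 0 := fun s =>
    (Finset.prod_pos fun y _ => sub_pos.2 (one_lt_pow₀ (by linarith) (by omega))).ne'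
  have hpos2 : ∀ s : Finset ℕ, (∏ y ∈ s, (q ^ (y + 1) + 1)) ≠ 0 := fun s =>
    (Finset.prod_pos fun y _ => by positivity).ne'
  have hexp : (if shiftRow l = shiftRow m then (shiftRow l).card
      else ((shiftRow l).card + (shiftRow m).card - 2) / 2) =
      (if l = m then l.card else (l.card + m.card - 2) / 2) + 1 := by
    simp only [shiftRow_injective.eq_iff, shiftRow_card]
    obtain ⟨r, hr⟩ := heven
    split_ifs
    · rfl
    · omega
  unfold gdegD
  rw [hexp, prodDiff_shiftRow hq, prodDiff_shiftRow hq, prodSum_shiftRow, prodDen_shiftRow,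
    prodDen_shiftRow, shiftRow_card, shiftRow_card, symbN_succ_succ, choose_two_add, hfac, hfac]
  have h1 := hpos1 l
  have h2 := hpos1 m
  have h3 := hpos2 l
  have h4 := hpos2 m
  have h5 := (prodDen_pos hq l).ne'
  have h6 := (prodDen_pos hq m).ne'
  have h7 : q ≠ 0 := by linarith
  rw [div_eq_div_iff (by positivity) (by positivity)]
  ring

/-! ### Effect of decreasing one entry -/

/-- Comparison of products over a subset, deduced from a comparison of the full products whose
factors satisfy the opposite inequality. -/
lemma prod_ratio_subset {s t : Finset ℕ} (hst : s ⊆ t) {f g : ℕ → ℚ} {A B : ℚ}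
    (hf : ∀ i ∈ t, 0 < f i) (hg : ∀ i ∈ t, 0 < g i) (hgf : ∀ i ∈ t, g i ≤ f i) (hA : 0 ≤ A)
    (h : A * ∏ i ∈ t, f i ≤ B * ∏ i ∈ t, g i) :
    A * ∏ i ∈ s, f i ≤ B * ∏ i ∈ s, g i := by
  have hle : ∏ i ∈ t \ s, g i ≤ ∏ i ∈ t \ s, f i :=
    Finset.prod_le_prod (fun i hi => (hg i (Finset.sdiff_subset hi)).le)
      fun i hi => hgf i (Finset.sdiff_subset hi)
  have hpos : 0 < ∏ i ∈ t \ s, g i := Finset.prod_pos fun i hi => hg i (Finset.sdiff_subset hi)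
  have hfs : 0 < ∏ i ∈ s, f i := Finset.prod_pos fun i hi => hf i (hst hi)
  rw [← Finset.prod_sdiff hst, ← Finset.prod_sdiff hst] at h
  refine le_of_mul_le_mul_left ?_ hpos
  calc (∏ i ∈ t \ s, g i) * (A * ∏ i ∈ s, f i)
      ≤ (∏ i ∈ t \ s, f i) * (A * ∏ i ∈ s, f i) := by gcongr
    _ = A * ((∏ i ∈ t \ s, f i) * ∏ i ∈ s, f i) := by ring
    _ ≤ B * ((∏ i ∈ t \ s, g i) * ∏ i ∈ s, g i) := h
    _ = _ := by ring

lemma prod_sub_above {q : ℚ} (hq : 2 ≤ q) (x : ℕ) {s : Finset ℕ} (hs : ∀ y ∈ s, x + 1 < y) :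
    ∏ y ∈ s, (q ^ y - q ^ x) ≤ q * ∏ y ∈ s, (q ^ y - q ^ (x + 1)) := by
  have hq1 : 1 < q := by linarith
  obtain ⟨B, hB⟩ : ∃ B, s ⊆ Finset.Ico (x + 2) (x + 2 + B) :=
    ⟨s.sup id + 1, fun y hy => Finset.mem_Ico.2
      ⟨hs y hy, by have : y ≤ s.sup id := Finset.le_sup (f := id) hy
                   omega⟩⟩
  have hfull : ∀ B : ℕ,
      q ^ B * (q - 1) * ∏ y ∈ Finset.Ico (x + 2) (x + 2 + B), (q ^ y - q ^ x) =
        (q ^ (B + 1) - 1) * ∏ y ∈ Finset.Ico (x + 2) (x + 2 + B), (q ^ y - q ^ (x + 1)) := by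
    intro B
    induction B with
    | zero => simp
    | succ B ih =>
      rw [← add_assoc, Finset.prod_Ico_succ_top (by omega), Finset.prod_Ico_succ_top (by omega)]
      calc _ = (q ^ B * (q - 1) * ∏ y ∈ Finset.Ico (x + 2) (x + 2 + B), (q ^ y - q ^ x)) *
            (q * (q ^ (x + 2 + B) - q ^ x)) := by ring
        _ = _ := by rw [ih]; ring
  have hlt : ∀ y ∈ Finset.Ico (x + 2) (x + 2 + B), q ^ (x + 1) < q ^ y := fun y hy =>
    pow_lt_pow_right₀ hq1 (by have := (Finset.mem_Ico.1 hy).1; omega)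
  have hxx : q ^ x ≤ q ^ (x + 1) := pow_le_pow_right₀ hq1.le (by omega)
  have := prod_ratio_subset (A := 1) (B := q) hB (f := fun y => q ^ y - q ^ x)
    (g := fun y => q ^ y - q ^ (x + 1)) (fun y hy => by have := hlt y hy; linarith)
    (fun y hy => by have := hlt y hy; linarith) (fun y _ => by linarith) zero_le_one (by
      have hG : 0 ≤ ∏ y ∈ Finset.Ico (x + 2) (x + 2 + B), (q ^ y - q ^ (x + 1)) :=
        Finset.prod_nonneg fun y hy => by have := hlt y hy; linarith
      have hc : 0 < q ^ B * (q - 1) := mul_pos (by positivity) (by linarith)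
      refine le_of_mul_le_mul_left ?_ hc
      rw [one_mul, hfull, ← mul_assoc]
      refine mul_le_mul_of_nonneg_right ?_ hG
      have : 0 < q ^ B := by positivity
      have e : q ^ B * (q - 1) * q = q ^ (B + 1) * (q - 1) := by ring
      have : 1 ≤ q ^ (B + 1) := one_le_pow₀ hq1.le
      nlinarith)
  simpa using this

lemma prod_add_below {q : ℚ} (hq : 2 ≤ q) (x : ℕ) {s : Finset ℕ} (hs : ∀ y ∈ s, y ≤ x) :
    q ^ s.card * ∏ y ∈ s, (q ^ x + q ^ y) ≤ q * ∏ y ∈ s, (q ^ (x + 1) + q ^ y) := by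
  have hq1 : 1 < q := by linarith
  have hB : s ⊆ Finset.range (x + 1) := fun y hy => Finset.mem_range.2 (by have := hs y hy; omega)
  have hfull : ∀ B : ℕ, (q ^ (x + 1) + 1) * ∏ y ∈ Finset.range B, (q ^ (x + 1) + q ^ (y + 1)) =
      (q ^ (x + 1) + q ^ B) * ∏ y ∈ Finset.range B, (q ^ (x + 1) + q ^ y) := by
    intro B
    induction B with
    | zero => simp
    | succ B ih =>
      rw [Finset.prod_range_succ, Finset.prod_range_succ]
      calc _ = ((q ^ (x + 1) + 1) * ∏ y ∈ Finset.range B, (q ^ (x + 1) + q ^ (y + 1))) *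
            (q ^ (x + 1) + q ^ (B + 1)) := by ring
        _ = _ := by rw [ih]; ring
  have := prod_ratio_subset (A := 1) (B := q) hB (f := fun y => q ^ (x + 1) + q ^ (y + 1))
    (g := fun y => q ^ (x + 1) + q ^ y) (fun y hy => by positivity)
    (fun y hy => by positivity)
    (fun y _ => by gcongr <;> first | exact hq1.le | omega) zero_le_one (by
      have hG : 0 ≤ ∏ y ∈ Finset.range (x + 1), (q ^ (x + 1) + q ^ y) :=
        Finset.prod_nonneg fun y hy => by positivity
      have hc : 0 < q ^ (x + 1) + 1 := by positivity
      refine le_of_mul_le_mul_left ?_ hc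
      rw [one_mul, hfull, ← mul_assoc]
      refine mul_le_mul_of_nonneg_right ?_ hG
      have : 0 < q ^ (x + 1) := by positivity
      nlinarith)
  rw [one_mul] at this
  refine le_trans (le_of_eq ?_) this
  rw [← Finset.prod_const, ← Finset.prod_mul_distrib]
  exact Finset.prod_congr rfl fun y _ => by ring

lemma prod_add_step {q : ℚ} (hq : 2 ≤ q) (x : ℕ) (m : Finset ℕ) :
    q ^ (m.filter (· ≤ x)).card * ∏ y ∈ m, (q ^ x + q ^ y) ≤
      q * ∏ y ∈ m, (q ^ (x + 1) + q ^ y) := by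
  have h1 := prod_add_below hq x (s := m.filter (· ≤ x)) fun y hy => (Finset.mem_filter.1 hy).2
  have h2 : ∏ y ∈ m.filter (fun y => ¬ y ≤ x), (q ^ x + q ^ y) ≤
      ∏ y ∈ m.filter (fun y => ¬ y ≤ x), (q ^ (x + 1) + q ^ y) :=
    Finset.prod_le_prod (fun y _ => by positivity) fun y _ => by
      gcongr
      · linarith
      · omega
  rw [← Finset.prod_filter_mul_prod_filter_not m (· ≤ x),
    ← Finset.prod_filter_mul_prod_filter_not m (· ≤ x) (fun y => q ^ (x + 1) + q ^ y),
    ← mul_assoc, ← mul_assoc]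
  exact mul_le_mul h1 h2 (Finset.prod_nonneg fun y _ => by positivity)
    (mul_nonneg (by linarith) (Finset.prod_nonneg fun y _ => by positivity))

lemma prod_abs_below {q : ℚ} (hq : 2 ≤ q) (x : ℕ) {s : Finset ℕ} (hs : ∀ y ∈ s, y < x) :
    q ^ s.card * ∏ y ∈ s, |q ^ x - q ^ y| ≤ ∏ y ∈ s, |q ^ (x + 1) - q ^ y| := by
  rw [← Finset.prod_const, ← Finset.prod_mul_distrib]
  refine Finset.prod_le_prod (fun y _ => by positivity) fun y hy => ?_
  have hq1 : 1 < q := by linarith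
  have h1 : q ^ y < q ^ x := pow_lt_pow_right₀ hq1 (hs y hy)
  have h2 : q ^ x < q ^ (x + 1) := pow_lt_pow_right₀ hq1 (by omega)
  have h3 : 0 < q ^ y := by positivity
  rw [abs_of_pos (by linarith), abs_of_pos (by linarith), pow_succ']
  nlinarith

lemma prod_abs_step {q : ℚ} (hq : 2 ≤ q) {x : ℕ} {l : Finset ℕ} (hx : x ∉ l) (hx1 : x + 1 ∉ l) :
    q ^ (l.filter (· < x)).card * ∏ y ∈ l, |q ^ x - q ^ y| ≤
      q * ∏ y ∈ l, |q ^ (x + 1) - q ^ y| := by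
  have hq1 : 1 < q := by linarith
  have h1 := prod_abs_below hq x (s := l.filter (· < x)) fun y hy => (Finset.mem_filter.1 hy).2
  have hab : ∀ y ∈ l.filter (fun y => ¬ y < x), x + 1 < y := fun y hy => by
    obtain ⟨hy1, hy2⟩ := Finset.mem_filter.1 hy
    have : y ≠ x := fun h => hx (h ▸ hy1)
    have : y ≠ x + 1 := fun h => hx1 (h ▸ hy1)
    omega
  have h2 : ∏ y ∈ l.filter (fun y => ¬ y < x), |q ^ x - q ^ y| ≤
      q * ∏ y ∈ l.filter (fun y => ¬ y < x), |q ^ (x + 1) - q ^ y| := by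
    have habs : ∀ z, z ≤ x + 1 → ∏ y ∈ l.filter (fun y => ¬ y < x), |q ^ z - q ^ y| =
        ∏ y ∈ l.filter (fun y => ¬ y < x), (q ^ y - q ^ z) := fun z hz =>
      Finset.prod_congr rfl fun y hy => by
        have : q ^ z < q ^ y := pow_lt_pow_right₀ hq1 (by have := hab y hy; omega)
        rw [abs_sub_comm, abs_of_pos (by linarith)]
    rw [habs x (by omega), habs (x + 1) le_rfl]
    exact prod_sub_above hq x hab
  rw [← Finset.prod_filter_mul_prod_filter_not l (· < x),
    ← Finset.prod_filter_mul_prod_filter_not l (· < x) (fun y => |q ^ (x + 1) - q ^ y|),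
    ← mul_assoc]
  refine (mul_le_mul h1 h2 (Finset.prod_nonneg fun y _ => by positivity)
    (Finset.prod_nonneg fun y _ => by positivity)).trans (le_of_eq ?_)
  ring

/-- Decreasing the entry `x + 1` of the first row divides the generic degree by at least `q ^ 4`,
as soon as the products over the other entries decrease enough. -/
lemma gdegD_decrease {q : ℚ} (hq : 2 ≤ q) {n x e c : ℕ} {l m : Finset ℕ} (hn : 1 ≤ n)
    (hx : x ∉ l) (hx1 : x + 1 ∉ l)
    (hprod : q ^ e * ((∏ y ∈ l, |q ^ x - q ^ y|) * ∏ y ∈ m, (q ^ x + q ^ y)) ≤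
      q ^ c * ((∏ y ∈ l, |q ^ (x + 1) - q ^ y|) * ∏ y ∈ m, (q ^ (x + 1) + q ^ y)))
    (hexp : 2 * x + 5 + c + (if insert (x + 1) l = m then 1 else 0) ≤ 2 * n + e) :
    q ^ 4 * gdegD q n (insert x l) m ≤ gdegD q (n + 1) (insert (x + 1) l) m := by
  obtain ⟨n, rfl⟩ : ∃ k, n = k + 1 := ⟨n - 1, by omega⟩
  have hq1 : 1 < q := by linarith
  have hq0 : 0 < q := by linarith
  set T := (∏ y ∈ l, |q ^ x - q ^ y|) * ∏ y ∈ m, (q ^ x + q ^ y) with hT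
  set T' := (∏ y ∈ l, |q ^ (x + 1) - q ^ y|) * ∏ y ∈ m, (q ^ (x + 1) + q ^ y) with hT'
  have hT0 : 0 ≤ T := mul_nonneg (Finset.prod_nonneg fun y _ => by positivity)
    (Finset.prod_nonneg fun y _ => by positivity)
  set K := evenProd q n * prodDiff q l * prodDiff q m * prodSum q l m /
    (q ^ symbN (l.card + 1) m.card * evenProd q x * prodDen q l * prodDen q m) with hK
  have hD := evenProd_pos hq n
  have hDx := evenProd_pos hq x
  have hl := prodDiff_pos hq l
  have hm := prodDiff_pos hq m
  have hlm := prodSum_pos hq l m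
  have hdl := prodDen_pos hq l
  have hdm := prodDen_pos hq m
  have hK0 : 0 < K := by positivity
  set c₀ := if insert x l = m then l.card + 1 else (l.card + 1 + m.card - 2) / 2 with hc₀
  set c₁ := if insert (x + 1) l = m then l.card + 1 else (l.card + 1 + m.card - 2) / 2 with hc₁
  set δ := if insert (x + 1) l = m then 1 else 0 with hδ
  have hc : c₁ ≤ c₀ + δ := by
    have hcard : insert x l = m → m.card = l.card + 1 := fun h => by
      rw [← h, Finset.card_insert_of_notMem hx]
    have hcard' : insert (x + 1) l = m → m.card = l.card + 1 := fun h => by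
      rw [← h, Finset.card_insert_of_notMem hx1]
    rw [hc₀, hc₁, hδ]
    split_ifs with h1 h2 h2
    · omega
    · have := hcard' h1; omega
    · have := hcard h2; omega
    · omega
  have hQ : (0 : ℚ) < q ^ (2 * (x + 1)) - 1 := sub_pos.2 (one_lt_pow₀ hq1 (by omega))
  have e0 : gdegD q (n + 1) (insert x l) m = (q ^ (n + 1) - 1) * T * K / 2 ^ c₀ := by
    rw [gdegD_insert hq _ _ hx, hK, hT]
    simp only [Nat.add_sub_cancel]
    field_simp
    ring
  have e1 : gdegD q (n + 1 + 1) (insert (x + 1) l) m =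
      (q ^ (n + 2) - 1) * (q ^ (2 * (n + 1)) - 1) * T' * K /
        (2 ^ c₁ * (q ^ (2 * (x + 1)) - 1)) := by
    rw [gdegD_insert hq _ _ hx1, hK, hT']
    simp only [Nat.add_sub_cancel, evenProd_succ]
    field_simp
    ring
  rw [e0, e1, ← mul_div_assoc, div_le_div_iff₀ (by positivity) (by positivity)]
  have h2 : (2 : ℚ) ^ c₁ ≤ q ^ δ * 2 ^ c₀ :=
    calc (2 : ℚ) ^ c₁ ≤ 2 ^ (c₀ + δ) := pow_le_pow_right₀ (by norm_num) hc
      _ = 2 ^ δ * 2 ^ c₀ := by ring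
      _ ≤ q ^ δ * 2 ^ c₀ := by gcongr
  have hN : (0 : ℚ) < q ^ (n + 1) - 1 := sub_pos.2 (one_lt_pow₀ hq1 (by omega))
  have h3 : q ^ (2 * n + 3) ≤ (q ^ (n + 2) - 1) * (q ^ (n + 1) + 1) := by
    have : (q ^ (n + 2) - 1) * (q ^ (n + 1) + 1) =
        q ^ (2 * n + 3) + (q - 1) * q ^ (n + 1) - 1 := by ring
    have h4 : 1 ≤ q ^ (n + 1) := one_le_pow₀ hq1.le
    nlinarith
  have h5 : (q ^ (n + 2) - 1) * (q ^ (2 * (n + 1)) - 1) =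
      (q ^ (n + 2) - 1) * (q ^ (n + 1) + 1) * (q ^ (n + 1) - 1) := by ring
  have h6 : q ^ 4 * q ^ δ * (q ^ (2 * (x + 1)) - 1) * T ≤ q ^ (2 * n + 3) * T' := by
    have hce : 0 < q ^ c := by positivity
    refine le_of_mul_le_mul_left ?_ hce
    calc q ^ c * (q ^ 4 * q ^ δ * (q ^ (2 * (x + 1)) - 1) * T)
        ≤ q ^ c * (q ^ 4 * q ^ δ * (q ^ (2 * (x + 1))) * T) := by
          gcongr
          linarith
      _ = q ^ (c + 4 + δ + 2 * (x + 1)) * T := by ring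
      _ ≤ q ^ (2 * n + 3 + e) * T := by
          refine mul_le_mul_of_nonneg_right (pow_le_pow_right₀ hq1.le ?_) hT0
          omega
      _ = q ^ (2 * n + 3) * (q ^ e * T) := by ring
      _ ≤ q ^ (2 * n + 3) * (q ^ c * T') := by gcongr
      _ = _ := by ring
  have hT'0 : 0 ≤ T' := mul_nonneg (Finset.prod_nonneg fun y _ => by positivity)
    (Finset.prod_nonneg fun y _ => by positivity)
  calc q ^ 4 * ((q ^ (n + 1) - 1) * T * K) * (2 ^ c₁ * (q ^ (2 * (x + 1)) - 1))
      ≤ q ^ 4 * ((q ^ (n + 1) - 1) * T * K) * (q ^ δ * 2 ^ c₀ * (q ^ (2 * (x + 1)) - 1)) := by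
        gcongr
    _ = (q ^ 4 * q ^ δ * (q ^ (2 * (x + 1)) - 1) * T) * ((q ^ (n + 1) - 1) * K * 2 ^ c₀) := by
        ring
    _ ≤ (q ^ (2 * n + 3) * T') * ((q ^ (n + 1) - 1) * K * 2 ^ c₀) := by gcongr
    _ ≤ ((q ^ (n + 2) - 1) * (q ^ (n + 1) + 1) * T') * ((q ^ (n + 1) - 1) * K * 2 ^ c₀) := by
        gcongr
    _ = _ := by ring

/-! ### Explicit families -/

/-- The factor of the generic degree of `(x, l; m)` which does not involve the entry `x`. -/
def restFactor (q : ℚ) (l m : Finset ℕ) : ℚ :=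
  prodDiff q l * prodDiff q m * prodSum q l m /
    (2 ^ ((l.card + 1 + m.card - 2) / 2) * q ^ symbN (l.card + 1) m.card *
      (prodDen q l * prodDen q m))

lemma gdegD_insert_top {q : ℚ} (hq : 2 ≤ q) (n : ℕ) {x : ℕ} {l m : Finset ℕ}
    (hl : ∀ y ∈ l, y < x) (hne : insert x l ≠ m) :
    gdegD q n (insert x l) m = (q ^ n - 1) * (evenProd q (n - 1) / evenProd q x) *
      (∏ y ∈ l, (q ^ x - q ^ y)) * (∏ y ∈ m, (q ^ x + q ^ y)) * restFactor q l m := by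
  have habs : ∏ y ∈ l, |q ^ x - q ^ y| = ∏ y ∈ l, (q ^ x - q ^ y) :=
    Finset.prod_congr rfl fun y hy => abs_of_pos
      (sub_pos.2 (pow_lt_pow_right₀ (by linarith) (hl y hy)))
  rw [gdegD_insert hq n m fun h => lt_irrefl x (hl x h), if_neg hne, habs, restFactor]
  have := evenProd_pos hq x
  have := prodDen_pos hq l
  have := prodDen_pos hq m
  field_simp

lemma evenProd_one (q : ℚ) : evenProd q 1 = q ^ 2 - 1 := by simp [evenProd]

lemma evenProd_two (q : ℚ) : evenProd q 2 = (q ^ 2 - 1) * (q ^ 4 - 1) := by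
  rw [evenProd_succ, evenProd_one]

lemma evenProd_three (q : ℚ) :
    evenProd q 3 = (q ^ 2 - 1) * (q ^ 4 - 1) * (q ^ 6 - 1) := by
  rw [evenProd_succ, evenProd_two]

lemma prodDen_eq (q : ℚ) (l : Finset ℕ) : prodDen q l = ∏ x ∈ l, evenProd q x := rfl

section Families

variable {q : ℚ}

lemma sq_sub_one_pos (hq : 2 ≤ q) : 0 < q ^ 2 - 1 := by nlinarith

lemma pow_four_sub_one_pos (hq : 2 ≤ q) : 0 < q ^ 4 - 1 := by
  have := sq_sub_one_pos hq
  nlinarith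

lemma pow_six_sub_one_pos (hq : 2 ≤ q) : 0 < q ^ 6 - 1 :=
  sub_pos.2 (one_lt_pow₀ (by linarith) (by norm_num))

lemma restFactor_empty_two :
    restFactor q ∅ {2} = 1 / ((q ^ 2 - 1) * (q ^ 4 - 1)) := by
  have hN : symbN 1 1 = 0 := by decide
  simp [restFactor, prodDiff, prodSum, prodDen_eq, evenProd_two, hN]

lemma restFactor_empty_one : restFactor q ∅ {1} = 1 / (q ^ 2 - 1) := by
  have hN : symbN 1 1 = 0 := by decide
  simp [restFactor, prodDiff, prodSum, prodDen_eq, evenProd_one, hN]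

lemma restFactor_empty_zero : restFactor q ∅ {0} = 1 := by
  have hN : symbN 1 1 = 0 := by decide
  simp [restFactor, prodDiff, prodSum, prodDen_eq, evenProd_zero, hN]

lemma restFactor_one_zeroOne (hq : 2 ≤ q) :
    restFactor q {1} {0, 1} = 1 / (q ^ 2 - 1) := by
  have hN : symbN 2 2 = 1 := by decide
  have := sq_sub_one_pos hq
  have h0 : 0 < q := by linarith
  simp [restFactor, prodDiff, prodSum, prodDen_eq, evenProd_one, evenProd_zero, hN]
  field_simp
  ring

lemma restFactor_two_zeroOne (hq : 2 ≤ q) :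
    restFactor q {2} {0, 1} = 1 / (2 * (q ^ 2 - 1) ^ 2) := by
  have hN : symbN 2 2 = 1 := by decide
  have := sq_sub_one_pos hq
  have := pow_four_sub_one_pos hq
  have h0 : 0 < q := by linarith
  simp [restFactor, prodDiff, prodSum, prodDen_eq, evenProd_one, evenProd_two, evenProd_zero, hN]
  field_simp
  ring

lemma restFactor_one_zeroTwo (hq : 2 ≤ q) :
    restFactor q {1} {0, 2} = (q + 1) ^ 2 / (2 * (q ^ 2 - 1) * (q ^ 4 - 1)) := by
  have hN : symbN 2 2 = 1 := by decide
  have := sq_sub_one_pos hq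
  have := pow_four_sub_one_pos hq
  have h0 : 0 < q := by linarith
  simp [restFactor, prodDiff, prodSum, prodDen_eq, evenProd_one, evenProd_two, evenProd_zero, hN]
  field_simp
  ring

lemma restFactor_zero_oneTwo (hq : 2 ≤ q) :
    restFactor q {0} {1, 2} = 1 / (2 * (q ^ 2 - 1) ^ 2) := by
  have hN : symbN 2 2 = 1 := by decide
  have := sq_sub_one_pos hq
  have := pow_four_sub_one_pos hq
  have h0 : 0 < q := by linarith
  simp [restFactor, prodDiff, prodSum, prodDen_eq, evenProd_one, evenProd_two, evenProd_zero, hN]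
  field_simp
  ring

lemma restFactor_oneTwo_zeroOneTwo (hq : 2 ≤ q) :
    restFactor q {1, 2} {0, 1, 2} = 1 / ((q ^ 2 - 1) * (q ^ 4 - 1)) := by
  have hN : symbN 3 3 = 7 := by decide
  have := sq_sub_one_pos hq
  have := pow_four_sub_one_pos hq
  have h0 : 0 < q := by linarith
  simp [restFactor, prodDiff, prodSum, prodDen_eq, evenProd_one, evenProd_two, evenProd_zero,
    Finset.prod_insert, hN]
  field_simp
  ring

lemma restFactor_zeroOneTwo_empty (hq : 2 ≤ q) :
    restFactor q {0, 1, 2} ∅ = 1 / (2 * (q + 1) ^ 2 * (q ^ 2 + 1)) := by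
  have hN : symbN 4 0 = 1 := by decide
  have := sq_sub_one_pos hq
  have := pow_four_sub_one_pos hq
  have h0 : 0 < q := by linarith
  simp [restFactor, prodDiff, prodSum, prodDen_eq, evenProd_one, evenProd_two, evenProd_zero,
    Finset.prod_insert, hN]
  field_simp
  ring

lemma restFactor_zeroOneThree_empty (hq : 2 ≤ q) :
    restFactor q {0, 1, 3} ∅ = 1 / (2 * (q + 1) * (q ^ 4 - 1) * (q ^ 3 + 1)) := by
  have hN : symbN 4 0 = 1 := by decide
  have := sq_sub_one_pos hq
  have := pow_four_sub_one_pos hq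
  have := pow_six_sub_one_pos hq
  have h0 : 0 < q := by linarith
  simp [restFactor, prodDiff, prodSum, prodDen_eq, evenProd_one, evenProd_three, evenProd_zero,
    Finset.prod_insert, hN]
  field_simp
  ring

lemma restFactor_zeroOneTwoThree_one (hq : 2 ≤ q) :
    restFactor q {0, 1, 2, 3} {1} = 1 / (2 * (q + 1) * (q ^ 4 - 1) * (q ^ 3 + 1)) := by
  have hN : symbN 5 1 = 7 := by decide
  have := sq_sub_one_pos hq
  have := pow_four_sub_one_pos hq
  have := pow_six_sub_one_pos hq
  have h0 : 0 < q := by linarith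
  simp [restFactor, prodDiff, prodSum, prodDen_eq, evenProd_one, evenProd_two, evenProd_three,
    evenProd_zero, Finset.prod_insert, hN]
  field_simp
  ring

lemma evenProd_div_self (hq : 2 ≤ q) (k : ℕ) : evenProd q k / evenProd q k = 1 :=
  div_self (evenProd_pos hq k).ne'

lemma evenProd_succ_div (hq : 2 ≤ q) (k : ℕ) :
    evenProd q (k + 1) / evenProd q k = q ^ 2 * (q ^ k) ^ 2 - 1 := by
  rw [evenProd_succ, mul_div_cancel_left₀ _ (evenProd_pos hq k).ne']
  ring

lemma evenProd_pred_div (hq : 2 ≤ q) {k : ℕ} (hk : 1 ≤ k) :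
    evenProd q (k - 1) / evenProd q k = 1 / ((q ^ k) ^ 2 - 1) := by
  obtain ⟨k, rfl⟩ : ∃ j, k = j + 1 := ⟨k - 1, by omega⟩
  rw [Nat.add_sub_cancel, evenProd_succ, ← div_div, evenProd_div_self hq]
  ring_nf

lemma pow_le_pow_of_two_le (hq : 2 ≤ q) {i j : ℕ} (h : i ≤ j) : q ^ i ≤ q ^ j :=
  pow_le_pow_right₀ (by linarith) h

end Families

section FamilyBounds

variable {q : ℚ}

lemma gap_two_max (hq : 2 ≤ q) {k : ℕ} (hk : 2 ≤ k) :
    q ^ (4 * (k + 2)) < q ^ 10 * gdegD q (k + 2) {k} {2} := by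
  have h1 := sq_sub_one_pos hq
  have h2 := pow_four_sub_one_pos hq
  have hq0 : 0 < q := by linarith
  rcases Nat.lt_or_ge 2 k with hk3 | hk2
  · have hX : q ^ 3 ≤ q ^ k := pow_le_pow_of_two_le hq hk3
    have e := gdegD_insert_top hq (k + 2) (x := k) (l := ∅) (m := {2}) (by simp)
      (by simp; omega)
    simp only [insert_empty_eq, Finset.prod_empty, Finset.prod_singleton, restFactor_empty_two,
      show k + 2 - 1 = k + 1 by omega, evenProd_succ_div hq] at e
    rw [e, show q ^ (k + 2) = q ^ 2 * q ^ k by ring,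
      show q ^ (4 * (k + 2)) = q ^ 8 * (q ^ k) ^ 4 by ring]
    generalize q ^ k = X at *
    have hX1 : 1 ≤ X := le_trans (one_le_pow₀ (by linarith)) hX
    rw [mul_one_div, ← mul_div_assoc, lt_div_iff₀ (by positivity)]
    have a1 : q ^ 2 * X ^ 2 ≤ (q ^ 2 * X - 1) * (X + q ^ 2) := by nlinarith
    have a2 : 0 < q ^ 2 * X ^ 2 - 1 := by nlinarith
    have a3 : (q ^ 2 * X ^ 2) * (q ^ 2 * X ^ 2 - 1) ≤
        (q ^ 2 * X - 1) * (X + q ^ 2) * (q ^ 2 * X ^ 2 - 1) := by gcongr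
    have a4 : X ^ 4 * ((q ^ 2 - 1) * (q ^ 4 - 1)) <
        q ^ 2 * ((q ^ 2 * X ^ 2) * (q ^ 2 * X ^ 2 - 1)) := by
      have : 1 ≤ X ^ 2 := by nlinarith
      have b : 0 < X ^ 2 * (X ^ 2 * (q ^ 4 + q ^ 2 - 1) - q ^ 4) := by
        have : q ^ 4 + q ^ 2 - 1 ≤ X ^ 2 * (q ^ 4 + q ^ 2 - 1) :=
          le_mul_of_one_le_left (by nlinarith) this
        refine mul_pos (by positivity) (by linarith)
      nlinarith
    calc q ^ 8 * X ^ 4 * ((q ^ 2 - 1) * (q ^ 4 - 1))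
        = q ^ 8 * (X ^ 4 * ((q ^ 2 - 1) * (q ^ 4 - 1))) := by ring
      _ < q ^ 8 * (q ^ 2 * ((q ^ 2 * X ^ 2) * (q ^ 2 * X ^ 2 - 1))) := by gcongr
      _ ≤ q ^ 8 * (q ^ 2 * ((q ^ 2 * X - 1) * (X + q ^ 2) * (q ^ 2 * X ^ 2 - 1))) := by gcongr
      _ = _ := by ring
  · obtain rfl : k = 2 := by omega
    have hN : symbN 1 1 = 0 := by decide
    have h3 : evenProd q 3 / evenProd q 2 = q ^ 6 - 1 := by
      rw [evenProd_succ, mul_div_cancel_left₀ _ (evenProd_pos hq 2).ne']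
    have e := gdegD_insert hq 4 (x := 2) (l := ∅) {2} (by simp)
    have e' : gdegD q 4 {2} {2} = q ^ 2 * (q ^ 4 + q ^ 2 + 1) := by
      rw [insert_empty_eq] at e
      rw [e]
      simp [hN, prodDiff, prodSum, prodDen_eq, evenProd_two, evenProd_three]
      field_simp
      ring
    rw [e']
    have : q ^ 10 * (q ^ 2 * (q ^ 4 + q ^ 2 + 1)) = q ^ 16 + q ^ 12 * (q ^ 2 + 1) := by ring
    rw [this]
    have : 0 < q ^ 12 * (q ^ 2 + 1) := by positivity
    simpa using this

lemma gap_twoMax_zeroOne (hq : 2 ≤ q) {k : ℕ} (hk : 3 ≤ k) :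
    q ^ (4 * (k + 1)) < q ^ 10 * gdegD q (k + 1) {k, 2} {0, 1} := by
  have h1 := sq_sub_one_pos hq
  have hq0 : 0 < q := by linarith
  have hX : q ^ 3 ≤ q ^ k := pow_le_pow_of_two_le hq hk
  rw [gdegD_insert_top hq (k + 1) (by simp; omega)
    (fun h => by have : k ∈ ({0, 1} : Finset ℕ) := h ▸ Finset.mem_insert_self _ _
                 simp at this; omega)]
  simp only [Finset.prod_singleton, Finset.prod_pair zero_ne_one, restFactor_two_zeroOne hq,
    Nat.add_sub_cancel, evenProd_div_self hq, pow_zero, pow_one, mul_one]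
  rw [show q ^ (k + 1) = q * q ^ k by ring,
    show q ^ (4 * (k + 1)) = q ^ 4 * (q ^ k) ^ 4 by ring]
  generalize q ^ k = X at *
  have hX0 : 0 < X := lt_of_lt_of_le (by positivity) hX
  have hX1 : 1 ≤ X := le_trans (one_le_pow₀ (by linarith)) hX
  rw [mul_one_div, ← mul_div_assoc, lt_div_iff₀ (by positivity)]
  have a1 : q * X ^ 2 ≤ (q * X - 1) * (X + 1) := by nlinarith
  have a2 : X ^ 2 / 2 ≤ (X - q ^ 2) * (X + q) := by
    have : q ^ 2 ≤ X / 2 := by nlinarith [sq_nonneg q]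
    nlinarith
  have a3 : (q ^ 2 - 1) ^ 2 ≤ q ^ 4 := by nlinarith
  have a4 : 8 ≤ q ^ 3 := by
    calc (8 : ℚ) = 2 ^ 3 := by norm_num
      _ ≤ q ^ 3 := by gcongr
  have b1 : 0 ≤ (q * X - 1) * (X + 1) := le_trans (by positivity) a1
  calc q ^ 4 * X ^ 4 * (2 * (q ^ 2 - 1) ^ 2) ≤ q ^ 4 * X ^ 4 * (2 * q ^ 4) := by gcongr
    _ = q ^ 8 * X ^ 4 * 2 := by ring
    _ < q ^ 8 * X ^ 4 * (q ^ 3 / 2) := by gcongr; linarith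
    _ = q ^ 10 * ((q * X ^ 2) * (X ^ 2 / 2)) := by ring
    _ ≤ q ^ 10 * (((q * X - 1) * (X + 1)) * ((X - q ^ 2) * (X + q))) := by gcongr
    _ = _ := by ring

lemma gap_oneMax_zeroTwo (hq : 2 ≤ q) {k : ℕ} (hk : 2 ≤ k) :
    q ^ (4 * (k + 1)) < q ^ 10 * gdegD q (k + 1) {k, 1} {0, 2} := by
  have h1 := sq_sub_one_pos hq
  have h2 := pow_four_sub_one_pos hq
  have hq0 : 0 < q := by linarith
  have hX : q ^ 2 ≤ q ^ k := pow_le_pow_of_two_le hq hk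
  rw [gdegD_insert_top hq (k + 1) (by simp; omega)
    (fun h => by have : 1 ∈ ({0, 2} : Finset ℕ) := h ▸ (by simp)
                 simp at this)]
  simp only [Finset.prod_singleton, Finset.prod_pair (show 0 ≠ 2 by norm_num),
    restFactor_one_zeroTwo hq, Nat.add_sub_cancel, evenProd_div_self hq, pow_zero, pow_one, mul_one]
  rw [show q ^ (k + 1) = q * q ^ k by ring,
    show q ^ (4 * (k + 1)) = q ^ 4 * (q ^ k) ^ 4 by ring]
  generalize q ^ k = X at *
  have hX0 : 0 < X := lt_of_lt_of_le (by positivity) hX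
  have hX1 : 1 ≤ X := le_trans (one_le_pow₀ (by linarith)) hX
  rw [← mul_div_assoc, ← mul_div_assoc, lt_div_iff₀ (by positivity)]
  have a1 : q * X ^ 2 ≤ (q * X - 1) * (X + 1) := by nlinarith
  have a2 : X ^ 2 ≤ (X - q) * (X + q ^ 2) := by
    have : q ^ 3 ≤ (q ^ 2 - q) * X := by nlinarith [mul_nonneg hq0.le (sub_nonneg.2 hX)]
    nlinarith
  have a3 : (q ^ 2 - 1) * (q ^ 4 - 1) ≤ q ^ 2 * q ^ 4 := by gcongr <;> linarith
  have a5 : q ^ 2 ≤ (q + 1) ^ 2 := by nlinarith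
  have a4 : 8 ≤ q ^ 3 := by
    calc (8 : ℚ) = 2 ^ 3 := by norm_num
      _ ≤ q ^ 3 := by gcongr
  have b1 : 0 ≤ (q * X - 1) * (X + 1) := le_trans (by positivity) a1
  have b2 : 0 ≤ (X - q) * (X + q ^ 2) := le_trans (by positivity) a2
  calc q ^ 4 * X ^ 4 * (2 * (q ^ 2 - 1) * (q ^ 4 - 1))
      = 2 * (q ^ 4 * X ^ 4 * ((q ^ 2 - 1) * (q ^ 4 - 1))) := by ring
    _ ≤ 2 * (q ^ 4 * X ^ 4 * (q ^ 2 * q ^ 4)) := by gcongr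
    _ = q ^ 10 * X ^ 4 * 2 := by ring
    _ < q ^ 10 * X ^ 4 * q ^ 3 := by gcongr; linarith
    _ = q ^ 10 * ((q * X ^ 2) * X ^ 2) * q ^ 2 := by ring
    _ ≤ q ^ 10 * (((q * X - 1) * (X + 1)) * ((X - q) * (X + q ^ 2))) * (q + 1) ^ 2 := by gcongr
    _ = _ := by ring

lemma gap_zeroMax_oneTwo (hq : 2 ≤ q) {k : ℕ} (hk : 2 ≤ k) :
    q ^ (4 * (k + 1)) < q ^ 10 * gdegD q (k + 1) {k, 0} {1, 2} := by
  have h1 := sq_sub_one_pos hq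
  have hq0 : 0 < q := by linarith
  have hX : q ^ 2 ≤ q ^ k := pow_le_pow_of_two_le hq hk
  rw [gdegD_insert_top hq (k + 1) (by simp; omega)
    (fun h => by have : 0 ∈ ({1, 2} : Finset ℕ) := h ▸ (by simp)
                 simp at this)]
  simp only [Finset.prod_singleton, Finset.prod_pair (show 1 ≠ 2 by norm_num),
    restFactor_zero_oneTwo hq, Nat.add_sub_cancel, evenProd_div_self hq, pow_zero, pow_one, mul_one]
  rw [show q ^ (k + 1) = q * q ^ k by ring,
    show q ^ (4 * (k + 1)) = q ^ 4 * (q ^ k) ^ 4 by ring]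
  generalize q ^ k = X at *
  have hX0 : 0 < X := lt_of_lt_of_le (by positivity) hX
  have hX1 : 1 ≤ X := le_trans (one_le_pow₀ (by linarith)) hX
  rw [mul_one_div, ← mul_div_assoc, lt_div_iff₀ (by positivity)]
  have a1 : X ≤ q * X - 1 := by nlinarith
  have a2 : X ^ 2 ≤ (X - 1) * (X + q) := by nlinarith
  have a6 : X ≤ X + q ^ 2 := by nlinarith
  have a3 : (q ^ 2 - 1) ^ 2 ≤ q ^ 4 := by nlinarith
  have a4 : 4 ≤ q ^ 2 := by nlinarith
  have b1 : 0 ≤ q * X - 1 := le_trans (by positivity) a1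
  have b2 : 0 ≤ (X - 1) * (X + q) := le_trans (by positivity) a2
  calc q ^ 4 * X ^ 4 * (2 * (q ^ 2 - 1) ^ 2) ≤ q ^ 4 * X ^ 4 * (2 * q ^ 4) := by gcongr
    _ = q ^ 8 * X ^ 4 * 2 := by ring
    _ < q ^ 8 * X ^ 4 * q ^ 2 := by gcongr; linarith
    _ = q ^ 10 * (X * X ^ 2 * X) := by ring
    _ ≤ q ^ 10 * ((q * X - 1) * ((X - 1) * (X + q)) * (X + q ^ 2)) := by gcongr
    _ = _ := by ring

lemma gap_oneTwoMax_zeroOneTwo (hq : 2 ≤ q) {k : ℕ} (hk : 3 ≤ k) :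
    q ^ (4 * k) < q ^ 10 * gdegD q k {k, 1, 2} {0, 1, 2} := by
  have h1 := sq_sub_one_pos hq
  have h2 := pow_four_sub_one_pos hq
  have hq0 : 0 < q := by linarith
  have hX : q ^ 3 ≤ q ^ k := pow_le_pow_of_two_le hq hk
  rw [gdegD_insert_top hq k (by simp; omega)
    (fun h => by have : 0 ∈ ({k, 1, 2} : Finset ℕ) := h ▸ (by simp)
                 simp at this; omega), evenProd_pred_div hq (by omega)]
  rw [restFactor_oneTwo_zeroOneTwo hq, Finset.prod_pair (by norm_num), Finset.prod_insert (by simp),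
    Finset.prod_pair (by norm_num)]
  simp only [pow_zero, pow_one]
  rw [show q ^ (4 * k) = (q ^ k) ^ 4 by ring]
  generalize q ^ k = X at *
  have hX8 : 2 ^ 3 ≤ X := le_trans (by gcongr) hX
  have hX0 : 0 < X := by linarith
  have hX2 : 0 < X ^ 2 - 1 := by nlinarith
  have e : (X - 1) * (1 / (X ^ 2 - 1)) * ((X - q) * (X - q ^ 2)) *
      ((X + 1) * ((X + q) * (X + q ^ 2))) * (1 / ((q ^ 2 - 1) * (q ^ 4 - 1))) =
      (X ^ 2 - q ^ 2) * (X ^ 2 - q ^ 4) / ((q ^ 2 - 1) * (q ^ 4 - 1)) := by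
    field_simp
    ring
  rw [e, ← mul_div_assoc, lt_div_iff₀ (by positivity)]
  have a0 : q ^ 2 ≤ X / 2 := by nlinarith [sq_nonneg q]
  have a1 : X ^ 2 / 2 ≤ X ^ 2 - q ^ 4 := by nlinarith
  have a2 : X ^ 2 / 2 ≤ X ^ 2 - q ^ 2 := by nlinarith
  have a3 : (q ^ 2 - 1) * (q ^ 4 - 1) ≤ q ^ 2 * q ^ 4 := by gcongr <;> linarith
  have a4 : 2 ^ 4 ≤ q ^ 4 := by gcongr
  have b2 : 0 ≤ X ^ 2 - q ^ 2 := le_trans (by positivity) a2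
  calc X ^ 4 * ((q ^ 2 - 1) * (q ^ 4 - 1)) ≤ X ^ 4 * (q ^ 2 * q ^ 4) := by gcongr
    _ = X ^ 4 * q ^ 6 * 1 := by ring
    _ < X ^ 4 * q ^ 6 * (q ^ 4 / 4) := by gcongr; linarith
    _ = q ^ 10 * ((X ^ 2 / 2) * (X ^ 2 / 2)) := by ring
    _ ≤ q ^ 10 * ((X ^ 2 - q ^ 2) * (X ^ 2 - q ^ 4)) := by gcongr

lemma gap_zeroOneTwoMax_empty (hq : 2 ≤ q) {k : ℕ} (hk : 5 ≤ k ∨ (k = 4 ∧ 3 ≤ q)) :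
    q ^ (4 * (k + 1)) < q ^ 10 * gdegD q (k + 1) {k, 0, 1, 2} ∅ := by
  have hq0 : 0 < q := by linarith
  have hk4 : 4 ≤ k := by omega
  rw [gdegD_insert_top hq (k + 1) (by simp; omega) (Finset.insert_ne_empty _ _),
    Finset.prod_insert (by simp), Finset.prod_pair (by norm_num), restFactor_zeroOneTwo_empty hq]
  simp only [Nat.add_sub_cancel, evenProd_div_self hq, pow_zero, pow_one, mul_one,
    Finset.prod_empty]
  rw [show q ^ (k + 1) = q * q ^ k by ring,
    show q ^ (4 * (k + 1)) = q ^ 4 * (q ^ k) ^ 4 by ring]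
  have key : ∀ X A B : ℚ, 0 < X → 0 < A →
      A * (q * X ^ 4) ≤ (q * X - 1) * ((X - 1) * ((X - q) * (X - q ^ 2))) →
      2 * (q + 1) ^ 2 * (q ^ 2 + 1) ≤ B * q ^ 4 → B < A * q ^ 3 →
      q ^ 4 * X ^ 4 < q ^ 10 * ((q * X - 1) * ((X - 1) * ((X - q) * (X - q ^ 2))) *
        (1 / (2 * (q + 1) ^ 2 * (q ^ 2 + 1)))) := by
    intro X A B hX hA h1 h2 h3
    rw [mul_one_div, ← mul_div_assoc, lt_div_iff₀ (by positivity)]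
    calc q ^ 4 * X ^ 4 * (2 * (q + 1) ^ 2 * (q ^ 2 + 1)) ≤ q ^ 4 * X ^ 4 * (B * q ^ 4) := by gcongr
      _ < q ^ 4 * X ^ 4 * (A * q ^ 3 * q ^ 4) := by gcongr
      _ = q ^ 10 * (A * (q * X ^ 4)) := by ring
      _ ≤ _ := by gcongr
  rcases hk with hk5 | ⟨rfl, hq3⟩
  · have hX : q ^ 5 ≤ q ^ k := pow_le_pow_of_two_le hq hk5
    generalize q ^ k = X at *
    have p2 : 4 ≤ q ^ 2 := by nlinarith
    have p3 : 8 ≤ q ^ 3 := by nlinarith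
    have p4 : 16 ≤ q ^ 4 := by nlinarith
    have p5 : 32 ≤ q ^ 5 := by nlinarith
    have c0 : 1 ≤ X / 32 := by linarith
    have hX0 : 0 < X := by linarith
    have c1 : q ≤ X / 16 := by nlinarith
    have c2 : q ^ 2 ≤ X / 8 := by nlinarith
    refine key X (3255 / 4096 * (63 / 64)) (45 / 8) hX0 (by norm_num) ?_ ?_ ?_
    · calc (3255 / 4096 * (63 / 64)) * (q * X ^ 4) = (63 / 64 * (q * X)) * ((31 / 32 * X) *
            ((15 / 16 * X) * (7 / 8 * X))) := by ring
        _ ≤ (q * X - 1) * ((X - 1) * ((X - q) * (X - q ^ 2))) := by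
          have : 64 ≤ q * X := by nlinarith
          refine mul_le_mul (by linarith) (mul_le_mul (by linarith) (mul_le_mul (by linarith)
            (by linarith) (by positivity) (by linarith)) (by positivity) (by linarith))
            (by positivity) (by linarith)
    · nlinarith [mul_le_mul (show (q + 1) ^ 2 ≤ 9 / 4 * q ^ 2 by nlinarith)
        (show q ^ 2 + 1 ≤ 5 / 4 * q ^ 2 by nlinarith) (by positivity) (by positivity)]
    · nlinarith
  · have p2 : 9 ≤ q ^ 2 := by nlinarith
    have p3 : 27 ≤ q ^ 3 := by nlinarith
    have p4 : 81 ≤ q ^ 4 := by nlinarith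
    refine key (q ^ 4) (1 / 4) 4 (by positivity) (by norm_num) ?_ ?_ ?_
    · have c1 : q ≤ q ^ 4 / 27 := by nlinarith
      have c2 : q ^ 2 ≤ q ^ 4 / 9 := by nlinarith
      generalize q ^ 4 = X at *
      calc (1 / 4) * (q * X ^ 4) ≤ (3 / 4 * (q * X)) * ((3 / 4 * X) *
            ((3 / 4 * X) * (3 / 4 * X))) := by
            have : 0 < q * X ^ 4 := by positivity
            nlinarith
        _ ≤ (q * X - 1) * ((X - 1) * ((X - q) * (X - q ^ 2))) := by
          have : 64 ≤ q * X := by nlinarith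
          refine mul_le_mul (by linarith) (mul_le_mul (by linarith) (mul_le_mul (by linarith)
            (by linarith) (by positivity) (by linarith)) (by positivity) (by linarith))
            (by positivity) (by linarith)
    · nlinarith [mul_le_mul (show (q + 1) ^ 2 ≤ 16 / 9 * q ^ 2 by nlinarith)
        (show q ^ 2 + 1 ≤ 10 / 9 * q ^ 2 by nlinarith) (by positivity) (by positivity)]
    · nlinarith

lemma restFactor_zeroOneThree_bound (hq : 2 ≤ q) :
    2 * (q + 1) * (q ^ 4 - 1) * (q ^ 3 + 1) ≤ 27 / 8 * q ^ 8 := by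
  have p3 : 8 ≤ q ^ 3 := by nlinarith [sq_nonneg q]
  have h := pow_four_sub_one_pos hq
  calc 2 * (q + 1) * (q ^ 4 - 1) * (q ^ 3 + 1)
      ≤ 2 * (3 / 2 * q) * q ^ 4 * (9 / 8 * q ^ 3) := by gcongr <;> linarith
    _ = _ := by ring

lemma gap_zeroOneThreeMax_empty (hq : 2 ≤ q) {k : ℕ} (hk : 4 ≤ k) :
    q ^ (4 * (k + 2)) < q ^ 10 * gdegD q (k + 2) {k, 0, 1, 3} ∅ := by
  have hq0 : 0 < q := by linarith
  have hX : q ^ 4 ≤ q ^ k := pow_le_pow_of_two_le hq hk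
  have hD := restFactor_zeroOneThree_bound hq
  have h4 := pow_four_sub_one_pos hq
  rw [gdegD_insert_top hq (k + 2) (by simp; omega) (Finset.insert_ne_empty _ _),
    Finset.prod_insert (by simp), Finset.prod_pair (by norm_num), restFactor_zeroOneThree_empty hq,
    show k + 2 - 1 = k + 1 by omega, evenProd_succ_div hq]
  simp only [pow_zero, pow_one, mul_one, Finset.prod_empty]
  rw [show q ^ (k + 2) = q ^ 2 * q ^ k by ring,
    show q ^ (4 * (k + 2)) = q ^ 8 * (q ^ k) ^ 4 by ring]
  generalize q ^ k = X at *
  have p2 : 4 ≤ q ^ 2 := by nlinarith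
  have p3 : 8 ≤ q ^ 3 := by nlinarith
  have p4 : 16 ≤ q ^ 4 := by nlinarith
  have hX0 : 0 < X := by linarith
  have c1 : q ≤ X / 8 := by nlinarith
  have c3 : q ^ 3 ≤ X / 2 := by nlinarith
  have c5 : 16 ≤ q ^ 2 * X := by nlinarith
  have c6 : 16 ≤ q ^ 2 * X ^ 2 := by nlinarith
  have c7 : q ^ 4 * 16 ≤ X * X := by nlinarith
  rw [mul_one_div, ← mul_div_assoc, lt_div_iff₀ (by positivity)]
  calc q ^ 8 * X ^ 4 * (2 * (q + 1) * (q ^ 4 - 1) * (q ^ 3 + 1))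
      ≤ q ^ 8 * X ^ 4 * (27 / 8 * q ^ 8) := by gcongr
    _ = q ^ 14 * X ^ 4 * (27 / 8 * q ^ 2) := by ring
    _ < q ^ 14 * X ^ 4 * (27 / 128 * (X * X)) :=
        mul_lt_mul_of_pos_left (by nlinarith) (by positivity)
    _ = q ^ 10 * ((3 / 4 * (q ^ 2 * X)) * (3 / 4 * (q ^ 2 * X ^ 2)) * (((3 / 4 * X) *
          (X * (1 / 2 * X))))) := by ring
    _ ≤ q ^ 10 * ((3 / 4 * (q ^ 2 * X)) * (3 / 4 * (q ^ 2 * X ^ 2)) * (((15 / 16 * X) *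
          ((7 / 8 * X) * (1 / 2 * X))))) := by
        have : 0 ≤ q ^ 10 * (q ^ 2 * X) * (q ^ 2 * X ^ 2) * X ^ 3 := by positivity
        linarith
    _ ≤ q ^ 10 * ((q ^ 2 * X - 1) * (q ^ 2 * X ^ 2 - 1) *
          ((X - 1) * ((X - q) * (X - q ^ 3)))) := by
        refine mul_le_mul_of_nonneg_left (mul_le_mul (mul_le_mul (by linarith) (by linarith)
          (by positivity) (by linarith)) (mul_le_mul (by linarith) (mul_le_mul (by linarith)
          (by linarith) (by positivity) (by linarith)) (by positivity) (by linarith))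
          (by positivity) (mul_nonneg (by linarith) (by linarith))) (by positivity)

lemma gap_zeroOneTwoThreeMax_one (hq : 2 ≤ q) {k : ℕ} (hk : 4 ≤ k) :
    q ^ (4 * (k + 1)) < q ^ 10 * gdegD q (k + 1) {k, 0, 1, 2, 3} {1} := by
  have hq0 : 0 < q := by linarith
  have hX : q ^ 4 ≤ q ^ k := pow_le_pow_of_two_le hq hk
  have hD := restFactor_zeroOneThree_bound hq
  have h4 := pow_four_sub_one_pos hq
  rw [gdegD_insert_top hq (k + 1) (by simp; omega)
    (fun h => by have : 0 ∈ ({1} : Finset ℕ) := h ▸ (by simp)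
                 simp at this),
    Finset.prod_insert (by simp), Finset.prod_insert (by simp), Finset.prod_pair (by norm_num),
    restFactor_zeroOneTwoThree_one hq]
  simp only [Nat.add_sub_cancel, evenProd_div_self hq, pow_zero, pow_one, mul_one,
    Finset.prod_singleton]
  rw [show q ^ (k + 1) = q * q ^ k by ring,
    show q ^ (4 * (k + 1)) = q ^ 4 * (q ^ k) ^ 4 by ring]
  generalize q ^ k = X at *
  have p2 : 4 ≤ q ^ 2 := by nlinarith
  have p3 : 8 ≤ q ^ 3 := by nlinarith
  have p4 : 16 ≤ q ^ 4 := by nlinarith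
  have hX0 : 0 < X := by linarith
  have c1 : q ≤ X / 8 := by nlinarith
  have c2 : q ^ 2 ≤ X / 4 := by nlinarith
  have c3 : q ^ 3 ≤ X / 2 := by nlinarith
  have c5 : 16 ≤ q * X := by nlinarith
  have c7 : q ^ 1 * 64 ≤ X * X := by nlinarith
  rw [mul_one_div, ← mul_div_assoc, lt_div_iff₀ (by positivity)]
  calc q ^ 4 * X ^ 4 * (2 * (q + 1) * (q ^ 4 - 1) * (q ^ 3 + 1))
      ≤ q ^ 4 * X ^ 4 * (27 / 8 * q ^ 8) := by gcongr
    _ = q ^ 11 * X ^ 4 * (27 / 8 * q) := by ring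
    _ < q ^ 11 * X ^ 4 * (27 / 128 * (X * X)) :=
        mul_lt_mul_of_pos_left (by linarith) (by positivity)
    _ = q ^ 10 * ((3 / 4 * (q * X)) * ((3 / 4 * X) * (X * ((3 / 4 * X) *
          (1 / 2 * X)))) * X) := by ring
    _ ≤ q ^ 10 * ((3 / 4 * (q * X)) * ((15 / 16 * X) * ((7 / 8 * X) * ((3 / 4 * X) *
          (1 / 2 * X)))) * X) := by
        have : 0 ≤ q ^ 10 * (q * X) * X ^ 5 := by positivity
        linarith
    _ ≤ q ^ 10 * ((q * X - 1) * ((X - 1) * ((X - q) * ((X - q ^ 2) * (X - q ^ 3)))) *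
          (X + q)) := by
        have d1 : 0 ≤ X - 1 := by linarith
        have d2 : 0 ≤ X - q := by linarith
        have d3 : 0 ≤ X - q ^ 2 := by linarith
        have d4 : 0 ≤ X - q ^ 3 := by linarith
        have d5 : 0 ≤ q * X - 1 := by linarith
        gcongr <;> linarith

lemma gap_three_three (hq : 2 ≤ q) : q ^ (4 * 6) < q ^ 10 * gdegD q 6 {3} {3} := by
  have hq0 : 0 < q := by linarith
  have h1 := sq_sub_one_pos hq
  have h2 := pow_four_sub_one_pos hq
  have h3 := pow_six_sub_one_pos hq
  have hN : symbN 1 1 = 0 := by decide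
  have h5 : evenProd q 5 = evenProd q 3 * (q ^ 8 - 1) * (q ^ 10 - 1) := by
    rw [evenProd_succ, evenProd_succ]
  have e := gdegD_insert hq 6 (x := 3) (l := ∅) {3} (by simp)
  have e' : gdegD q 6 {3} {3} = q ^ 3 * (q ^ 4 + 1) * (q ^ 10 - 1) / (q ^ 2 - 1) := by
    rw [insert_empty_eq] at e
    rw [e]
    simp [hN, prodDiff, prodSum, prodDen_eq, h5, evenProd_three]
    field_simp
    ring
  rw [e', ← mul_div_assoc, lt_div_iff₀ h1]
  have a : q ^ 4 ≤ q ^ 10 := pow_le_pow_of_two_le hq (by norm_num)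
  have c : q ^ 13 ≤ q ^ 14 := pow_le_pow_of_two_le hq (by norm_num)
  have d : 1 < q ^ 11 := one_lt_pow₀ (by linarith) (by norm_num)
  rw [← sub_pos]
  calc (0 : ℚ) < q ^ 13 * (q ^ 14 + q ^ 10 - q ^ 4 - 1 - q ^ 13 + q ^ 11) :=
        mul_pos (by positivity) (by linarith)
    _ = _ := by ring

lemma gap_oneTwo_oneTwo (hq : 2 ≤ q) : q ^ (4 * 4) < q ^ 10 * gdegD q 4 {1, 2} {1, 2} := by
  have hq0 : 0 < q := by linarith
  have h1 := sq_sub_one_pos hq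
  have h2 := pow_four_sub_one_pos hq
  have hN : symbN 2 2 = 1 := by decide
  have e := gdegD_insert hq 4 (x := 1) (l := {2}) {1, 2} (by simp)
  have habs : |q - q ^ 2| = q ^ 2 - q := by
    rw [abs_sub_comm, abs_of_pos (by nlinarith)]
  have hd : prodDiff q {2} = 1 := by simp [prodDiff]
  have hd' : prodDiff q {1, 2} = q ^ 2 - q := by simp [prodDiff]
  have e' : gdegD q 4 {1, 2} {1, 2} = q ^ 6 * (q ^ 4 + q ^ 2 + 1) := by
    rw [e]
    simp [hN, hd, hd', habs, prodSum, prodDen_eq, evenProd_one, evenProd_two, evenProd_three]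
    field_simp
    ring
  rw [e']
  rw [← sub_pos]
  calc (0 : ℚ) < q ^ 16 * (q ^ 4 + q ^ 2) := by positivity
    _ = _ := by ring

/-! ### The exceptional degrees -/

lemma gdegD_trivial (hq : 2 ≤ q) {n : ℕ} (hn : 1 ≤ n) : gdegD q n {n} {0} = 1 := by
  have e := gdegD_insert_top hq n (x := n) (l := ∅) (m := {0}) (by simp) (by simp; omega)
  have hX : q ^ 1 ≤ q ^ n := pow_le_pow_of_two_le hq hn
  simp only [insert_empty_eq, Finset.prod_empty, Finset.prod_singleton, restFactor_empty_zero,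
    evenProd_pred_div hq hn] at e
  rw [e]
  generalize q ^ n = X at *
  have : 0 < X ^ 2 - 1 := by nlinarith
  field_simp
  ring

lemma gdegD_pred_one (hq : 2 ≤ q) {n : ℕ} (hn : 3 ≤ n) :
    gdegD q n {n - 1} {1} = (q ^ n - 1) * (q ^ (n - 1) + q) / (q ^ 2 - 1) := by
  have e := gdegD_insert_top hq n (x := n - 1) (l := ∅) (m := {1}) (by simp) (by simp; omega)
  simp only [insert_empty_eq, Finset.prod_empty, Finset.prod_singleton, restFactor_empty_one,
    evenProd_div_self hq] at e
  rw [e]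
  ring

lemma gdegD_zeroOne_oneMax (hq : 2 ≤ q) {n : ℕ} (hn : 2 ≤ n) :
    gdegD q n {0, 1} {1, n} = (q ^ (2 * n) - q ^ 2) / (q ^ 2 - 1) := by
  have hX : q ^ 1 ≤ q ^ n := pow_le_pow_of_two_le hq (by omega)
  have h1 := sq_sub_one_pos hq
  rw [gdegD_comm, Finset.pair_comm 1 n, gdegD_insert_top hq n (by simp; omega)
    (fun h => by have : 0 ∈ ({n, 1} : Finset ℕ) := h ▸ (by simp)
                 simp at this; omega), evenProd_pred_div hq (by omega),
    restFactor_one_zeroOne hq, Finset.prod_pair (by norm_num), mul_comm 2 n, pow_mul]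
  simp only [Finset.prod_singleton, pow_zero, pow_one]
  generalize q ^ n = X at *
  have : 0 < X ^ 2 - 1 := by nlinarith
  field_simp
  ring

lemma gdegD_two_zeroOneTwoFour : gdegD (2 : ℚ) 5 {0, 1, 2, 4} ∅ = 868 := by
  rw [show ({0, 1, 2, 4} : Finset ℕ) = {4, 0, 1, 2} by decide,
    gdegD_insert_top le_rfl 5 (by simp) (Finset.insert_ne_empty _ _),
    Finset.prod_insert (by simp), Finset.prod_pair (by norm_num),
    restFactor_zeroOneTwo_empty le_rfl, Nat.add_sub_cancel 4 1, evenProd_div_self le_rfl]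
  norm_num

end FamilyBounds

/-! ### Symbols with prescribed defect -/

/-- The pair `(l; m)` has `2 * s` entries in total, defect `2 * u` with `u` even, and rank `n`. -/
structure HasRankD (n : ℕ) (s u : ℤ) (l m : Finset ℕ) : Prop where
  card_left : (l.card : ℤ) = s + u
  card_right : (m.card : ℤ) = s - u
  even : Even u
  sum_eq : ((l.sum id : ℕ) : ℤ) + ((m.sum id : ℕ) : ℤ) = n + s * (s - 1)

lemma HasRankD.symm {n : ℕ} {s u : ℤ} {l m : Finset ℕ} (h : HasRankD n s u l m) :
    HasRankD n s (-u) m l where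
  card_left := by rw [h.card_right]; ring
  card_right := by rw [h.card_left]; ring
  even := h.even.neg
  sum_eq := by rw [add_comm, h.sum_eq]

lemma card_mul_le_two_mul_sum (t : Finset ℕ) {j : ℕ} (hj : ∀ y ∈ t, j ≤ y) :
    (t.card : ℤ) * (t.card - 1) + 2 * j * t.card ≤ 2 * ((t.sum id : ℕ) : ℤ) := by
  induction t using Finset.induction_on_max with
  | empty => simp
  | insert a t ha ih =>
    have hat : a ∉ t := fun h => lt_irrefl a (ha a h)
    have hcard : t.card + j ≤ a := by
      have hsub : t ⊆ Finset.Ico j a := fun y hy =>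
        Finset.mem_Ico.2 ⟨hj y (Finset.mem_insert_of_mem hy), ha y hy⟩
      have := Finset.card_le_card hsub
      rw [Nat.card_Ico] at this
      have := hj a (Finset.mem_insert_self _ _)
      omega
    have := ih fun y hy => hj y (Finset.mem_insert_of_mem hy)
    rw [Finset.card_insert_of_notMem hat, Finset.sum_insert hat]
    push_cast at this ⊢
    zify at hcard
    simp only [id] at *
    nlinarith

lemma card_add_le_of_forall_mem {t : Finset ℕ} {j M : ℕ} (hj : ∀ y ∈ t, j ≤ y)
    (hM : ∀ y ∈ t, y ≤ M) (ht : t.Nonempty) : t.card + j ≤ M + 1 := by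
  have hsub : t ⊆ Finset.Icc j M := fun y hy => Finset.mem_Icc.2 ⟨hj y hy, hM y hy⟩
  have h := Finset.card_le_card hsub
  rw [Nat.card_Icc] at h
  obtain ⟨y, hy⟩ := ht
  have := hj y hy
  have := hM y hy
  omega

lemma one_le_of_zero_notMem {t : Finset ℕ} (h : 0 ∉ t) : ∀ y ∈ t, 1 ≤ y := fun _ hy =>
  Nat.one_le_iff_ne_zero.2 fun h0 => h (h0 ▸ hy)

lemma sum_erase_id {t : Finset ℕ} {x : ℕ} (hx : x ∈ t) :
    (((t.erase x).sum id : ℕ) : ℤ) = ((t.sum id : ℕ) : ℤ) - x := by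
  rw [← Finset.add_sum_erase t id hx]
  simp

lemma card_erase_cast {t : Finset ℕ} {x : ℕ} (hx : x ∈ t) :
    ((t.erase x).card : ℤ) = (t.card : ℤ) - 1 := by
  rw [← Finset.card_erase_add_one hx]
  simp

/-- Every symbol of positive rank can be replaced by a reduced one. -/
lemma HasRankD.exists_reduced {q : ℚ} (hq : 2 ≤ q) {n : ℕ} (hn : 1 ≤ n) {s u : ℤ}
    {l m : Finset ℕ} (h : HasRankD n s u l m) (C : ℤ)
    (hC : ∀ y, y ∈ l ∨ y ∈ m → (y : ℤ) + C ≤ n + s) :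
    ∃ (s' : ℤ) (l' m' : Finset ℕ), HasRankD n s' u l' m' ∧ ¬(0 ∈ l' ∧ 0 ∈ m') ∧
      (∀ y, y ∈ l' ∨ y ∈ m' → (y : ℤ) + C ≤ n + s') ∧ gdegD q n l m = gdegD q n l' m' := by
  induction hc : l.card generalizing s l m with
  | zero =>
    refine ⟨s, l, m, h, ?_, hC, rfl⟩
    rw [Finset.card_eq_zero.1 hc]
    simp
  | succ c ih =>
    by_cases h0 : 0 ∈ l ∧ 0 ∈ m
    · obtain ⟨l', rfl⟩ := exists_shiftRow h0.1
      obtain ⟨m', rfl⟩ := exists_shiftRow h0.2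
      have h1 := h.card_left
      have h2 := h.card_right
      have h3 := h.sum_eq
      rw [shiftRow_card] at h1 h2 hc
      rw [shiftRow_sum, shiftRow_sum] at h3
      push_cast at h1 h2 h3
      have h' : HasRankD n (s - 1) u l' m' :=
        ⟨by linarith, by linarith, h.even, by push_cast; linear_combination h3 - h1 - h2⟩
      have hlm : 1 ≤ l'.card + m'.card := by
        by_contra hlt
        have e1 : l' = ∅ := Finset.card_eq_zero.1 (by omega)
        have e2 : m' = ∅ := Finset.card_eq_zero.1 (by omega)
        subst e1 e2
        simp only [Finset.sum_empty, Finset.card_empty, Nat.cast_zero] at h1 h2 h3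
        have : s = 1 := by linarith
        subst this
        norm_num at h3
        omega
      have heven : Even (l'.card + m'.card) := by
        rw [← Int.even_coe_nat, Nat.cast_add, h'.card_left, h'.card_right]
        exact ⟨s - 1, by ring⟩
      obtain ⟨s', l'', m'', e1, e2, e3, e4⟩ := ih h' (by
        intro y hy
        have := hC (y + 1) (by simpa [shiftRow] using hy)
        push_cast at this
        linarith) (by omega)
      exact ⟨s', l'', m'', e1, e2, e3, by rw [gdegD_shiftRow hq n l' m' hlm heven, e4]⟩
    · exact ⟨s, l, m, h, h0, hC, rfl⟩

/-- The final run of consecutive entries of a row. -/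
lemma exists_run {l : Finset ℕ} {M : ℕ} (hM : M ∈ l) (hmax : ∀ y ∈ l, y ≤ M) :
    (∃ x, x ∉ l ∧ x + 1 ≤ M ∧ ∀ y, x + 1 ≤ y → y ≤ M → y ∈ l) ∨ l = Finset.range (M + 1) := by
  by_cases h : ∃ x, x ≤ M ∧ x ∉ l
  · left
    obtain ⟨x0, hx0, hx0l⟩ := h
    have hP : ∃ d, M - d ∉ l := ⟨M - x0, by rwa [Nat.sub_sub_self hx0]⟩
    classical
    have hd := Nat.find_spec hP
    have hmin := fun d (hd' : d < Nat.find hP) => Nat.find_min hP hd'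
    have hle : Nat.find hP ≤ M - x0 := Nat.find_min' hP (by rwa [Nat.sub_sub_self hx0])
    have hpos : Nat.find hP ≠ 0 := fun h0 => by
      rw [h0] at hd
      exact hd hM
    refine ⟨M - Nat.find hP, hd, by omega, fun y hy1 hy2 => ?_⟩
    have := hmin (M - y) (by omega)
    rwa [not_not, Nat.sub_sub_self hy2] at this
  · right
    push Not at h
    ext y
    exact ⟨fun hy => Finset.mem_range.2 (by have := hmax y hy; omega),
      fun hy => h y (by have := Finset.mem_range.1 hy; omega)⟩

lemma filter_lt_card_of_run {l : Finset ℕ} {x B : ℕ} (hx : x ∉ l)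
    (hmax : ∀ y ∈ l, y ≤ B) (hrun : ∀ y, x + 1 ≤ y → y ≤ B → y ∈ l) :
    (l.filter (· < x)).card + (B - x) = l.card := by
  have h : l.filter (fun y => ¬ y < x) = Finset.Icc (x + 1) B := by
    ext y
    simp only [Finset.mem_filter, Finset.mem_Icc, not_lt]
    refine ⟨fun ⟨h1, h2⟩ => ⟨?_, hmax y h1⟩, fun ⟨h1, h2⟩ => ⟨hrun y h1 h2, by omega⟩⟩
    have : y ≠ x := fun e => hx (e ▸ h1)
    omega
  have := Finset.card_filter_add_card_filter_not (s := l) (· < x)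
  rw [h, Nat.card_Icc] at this
  omega

lemma gdegD_decrease_run {q : ℚ} (hq : 2 ≤ q) {n x B : ℕ} {l m : Finset ℕ} (hn : 1 ≤ n)
    (hx : x ∉ l) (hxB : x + 1 ≤ B) (hmax : ∀ y ∈ l, y ≤ B)
    (hrun : ∀ y, x + 1 ≤ y → y ≤ B → y ∈ l)
    (hexp : 2 * x + 5 + (if x + 1 = B then 1 else 2) + (if l = m then 1 else 0) + (B - x) ≤
      2 * n + l.card + (m.filter (· ≤ x)).card) :
    q ^ 4 * gdegD q n (insert x (l.erase (x + 1))) m ≤ gdegD q (n + 1) l m := by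
  have hx1 : x + 1 ∈ l := hrun _ le_rfl hxB
  have hins : insert (x + 1) (l.erase (x + 1)) = l := Finset.insert_erase hx1
  have hxe : x ∉ l.erase (x + 1) := fun h => hx (Finset.mem_of_mem_erase h)
  have hxe1 : x + 1 ∉ l.erase (x + 1) := Finset.notMem_erase _ _
  have hfil : (l.erase (x + 1)).filter (· < x) = l.filter (· < x) := by
    ext y
    simp only [Finset.mem_filter, Finset.mem_erase]
    exact ⟨fun h => ⟨h.1.2, h.2⟩, fun h => ⟨⟨by omega, h.1⟩, h.2⟩⟩
  have hcard := filter_lt_card_of_run hx hmax hrun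
  have hm := prod_add_step hq x m
  have hq0 : 0 < q := by linarith
  have habs : q ^ (l.filter (· < x)).card * ∏ y ∈ l.erase (x + 1), |q ^ x - q ^ y| ≤
      q ^ (if x + 1 = B then 0 else 1) * ∏ y ∈ l.erase (x + 1), |q ^ (x + 1) - q ^ y| := by
    split_ifs with hB
    · have hlt : ∀ y ∈ l.erase (x + 1), y < x := fun y hy => by
        obtain ⟨h1, h2⟩ := Finset.mem_erase.1 hy
        have := hmax y h2
        have : y ≠ x := fun e => hx (e ▸ h2)
        omega
      rw [← hfil, Finset.filter_true_of_mem hlt, pow_zero, one_mul]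
      exact prod_abs_below hq x hlt
    · rw [← hfil, pow_one]
      exact prod_abs_step hq hxe hxe1
  have := gdegD_decrease hq (n := n) (x := x) (l := l.erase (x + 1)) (m := m)
    (e := (l.filter (· < x)).card + (m.filter (· ≤ x)).card)
    (c := (if x + 1 = B then 0 else 1) + 1) hn hxe hxe1 ?_ ?_
  · rwa [hins] at this
  · calc _ = (q ^ (l.filter (· < x)).card * ∏ y ∈ l.erase (x + 1), |q ^ x - q ^ y|) *
          (q ^ (m.filter (· ≤ x)).card * ∏ y ∈ m, (q ^ x + q ^ y)) := by ring
      _ ≤ (q ^ (if x + 1 = B then 0 else 1) * ∏ y ∈ l.erase (x + 1), |q ^ (x + 1) - q ^ y|) *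
          (q * ∏ y ∈ m, (q ^ (x + 1) + q ^ y)) := by gcongr
      _ = _ := by ring
  · rw [hins]
    split_ifs at hexp ⊢ <;> omega

lemma HasRankD.decrease {n x : ℕ} {s u : ℤ} {l m : Finset ℕ} (h : HasRankD (n + 1) s u l m)
    (hx : x ∉ l) (hx1 : x + 1 ∈ l) : HasRankD n s u (insert x (l.erase (x + 1))) m := by
  have hxe : x ∉ l.erase (x + 1) := fun h => hx (Finset.mem_of_mem_erase h)
  refine ⟨?_, h.card_right, h.even, ?_⟩
  · rw [Finset.card_insert_of_notMem hxe, Finset.card_erase_add_one hx1, h.card_left]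
  · rw [Finset.sum_insert hxe]
    have h1 := sum_erase_id hx1
    have h2 := h.sum_eq
    push_cast at *
    simp only [id] at *
    linarith

section Excess

variable {n M : ℕ} {s u : ℤ} {l m : Finset ℕ}

lemma HasRankD.sum_erase_max (h : HasRankD n s u l m) (hM : M ∈ l) {k : ℤ}
    (hk : (M : ℤ) + 1 + k = n + s) :
    (((l.erase M).sum id : ℕ) : ℤ) + ((m.sum id : ℕ) : ℤ) = k + (s - 1) ^ 2 := by
  rw [sum_erase_id hM]
  linear_combination h.sum_eq - hk

lemma HasRankD.excess_ge (h : HasRankD n s u l m) (hM : M ∈ l) {k : ℤ}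
    (hk : (M : ℤ) + 1 + k = n + s) {i j : ℕ} (hi : ∀ y ∈ l, i ≤ y) (hj : ∀ y ∈ m, j ≤ y) :
    u ^ 2 - u + i * (s + u - 1) + j * (s - u) ≤ k := by
  have h1 := card_mul_le_two_mul_sum (l.erase M) fun y hy => hi y (Finset.mem_of_mem_erase hy)
  have h2 := card_mul_le_two_mul_sum m hj
  rw [card_erase_cast hM, h.card_left] at h1
  rw [h.card_right] at h2
  linarith [h.sum_erase_max hM hk]

lemma HasRankD.excess_ge_of_reduced (h : HasRankD n s u l m) (hM : M ∈ l) {k : ℤ}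
    (hk : (M : ℤ) + 1 + k = n + s) (hr : ¬(0 ∈ l ∧ 0 ∈ m)) :
    u ^ 2 - u + (s - u) ≤ k ∨ u ^ 2 - u + (s + u - 1) ≤ k := by
  by_cases h0 : 0 ∈ l
  · have := h.excess_ge hM hk (i := 0) (j := 1) (by simp)
      (one_le_of_zero_notMem fun hm => hr ⟨h0, hm⟩)
    left; push_cast at this; linarith
  · have := h.excess_ge hM hk (i := 1) (j := 0) (one_le_of_zero_notMem h0) (by simp)
    right; push_cast at this; linarith

lemma HasRankD.excess_ge_sq (h : HasRankD n s u l m) (hM : M ∈ l) {k : ℤ}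
    (hk : (M : ℤ) + 1 + k = n + s) : u ^ 2 - u ≤ k := by
  have := h.excess_ge hM hk (i := 0) (j := 0) (by simp) (by simp)
  push_cast at this
  linarith

lemma HasRankD.defect_eq_zero_or_two (h : HasRankD n s u l m) (hM : M ∈ l) {k : ℤ}
    (hk : (M : ℤ) + 1 + k = n + s) (hk3 : k ≤ 5) : u = 0 ∨ u = 2 := by
  have h1 := h.excess_ge_sq hM hk
  obtain ⟨v, hv⟩ := h.even
  have : -1 < v := by nlinarith
  have : v < 2 := by nlinarith
  interval_cases v <;> simp_all

lemma HasRankD.rows_mem (h : HasRankD n s u l m) (hM : M ∈ l) {k : ℤ}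
    (hk : (M : ℤ) + 1 + k = n + s) (hr : ¬(0 ∈ l ∧ 0 ∈ m)) {c d e : ℕ} (hc : s + u - 1 = c)
    (hd : s - u = d) (he : k + (s - 1) ^ 2 = e) :
    l.erase M ∈ Finset.powersetCard c (Finset.range (e + 1)) ∧
      m ∈ Finset.powersetCard d (Finset.range (e + 1)) ∧
      (l.erase M).sum id + m.sum id = e ∧ ¬(0 ∈ l.erase M ∧ 0 ∈ m) := by
  have hs : (l.erase M).sum id + m.sum id = e := by
    have := h.sum_erase_max hM hk
    rw [he] at this
    exact_mod_cast this
  have hle : ∀ t : Finset ℕ, t.sum id ≤ e → t ⊆ Finset.range (e + 1) := fun t ht y hy => by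
    have : y ≤ t.sum id := Finset.single_le_sum (f := id) (by simp) hy
    exact Finset.mem_range.2 (by omega)
  refine ⟨Finset.mem_powersetCard.2 ⟨hle _ (by omega), ?_⟩,
    Finset.mem_powersetCard.2 ⟨hle _ (by omega), ?_⟩, hs,
    fun h0 => hr ⟨Finset.mem_of_mem_erase h0.1, h0.2⟩⟩
  · have := card_erase_cast hM
    rw [h.card_left, hc] at this
    exact_mod_cast this
  · have := h.card_right
    rw [hd] at this
    exact_mod_cast this

lemma HasRankD.rows_nonneg (h : HasRankD n s u l m) (hM : M ∈ l) : 1 ≤ s + u ∧ 0 ≤ s - u := by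
  have h1 : 1 ≤ l.card := Finset.card_pos.2 ⟨M, hM⟩
  have h2 := h.card_left
  have h3 := h.card_right
  omega

lemma HasRankD.eq_of_excess_le_one (h : HasRankD n s 0 l m) (hM : M ∈ l) {k : ℤ}
    (hk : (M : ℤ) + 1 + k = n + s) (hr : ¬(0 ∈ l ∧ 0 ∈ m)) (hk1 : k ≤ 1) :
    (l = {n} ∧ m = {0}) ∨ (l = {n - 1} ∧ m = {1}) ∨ (l = {n, 1} ∧ m = {0, 1}) := by
  have h0 := h.excess_ge_sq hM hk
  have hs := h.excess_ge_of_reduced hM hk hr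
  have hn := h.rows_nonneg hM
  have hl := Finset.insert_erase hM
  have hs2 : s ≤ 2 := by omega
  have hs1 : 1 ≤ s := by omega
  have hk0 : 0 ≤ k := by omega
  interval_cases k
  · obtain rfl : s = 1 := by omega
    obtain rfl : M = n := by omega
    obtain ⟨e1, e2, e3⟩ := h.rows_mem hM hk hr (c := 0) (d := 1) (e := 0) rfl rfl rfl
    have key : ∀ l ∈ Finset.powersetCard 0 (Finset.range 1),
        ∀ m ∈ Finset.powersetCard 1 (Finset.range 1), l.sum id + m.sum id = 0 ∧ ¬(0 ∈ l ∧ 0 ∈ m) →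
        l = ∅ ∧ m = {0} := by decide
    obtain ⟨f1, f2⟩ := key _ e1 _ e2 e3
    left
    rw [← hl, f1]
    exact ⟨rfl, f2⟩
  · interval_cases s
    · obtain rfl : M = n - 1 := by omega
      obtain ⟨e1, e2, e3⟩ := h.rows_mem hM hk hr (c := 0) (d := 1) (e := 1) rfl rfl rfl
      have key : ∀ l ∈ Finset.powersetCard 0 (Finset.range 2),
          ∀ m ∈ Finset.powersetCard 1 (Finset.range 2),
          l.sum id + m.sum id = 1 ∧ ¬(0 ∈ l ∧ 0 ∈ m) → l = ∅ ∧ m = {1} := by decide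
      obtain ⟨f1, f2⟩ := key _ e1 _ e2 e3
      right; left
      rw [← hl, f1]
      exact ⟨rfl, f2⟩
    · obtain rfl : M = n := by omega
      obtain ⟨e1, e2, e3⟩ := h.rows_mem hM hk hr (c := 1) (d := 2) (e := 2) rfl rfl rfl
      have key : ∀ l ∈ Finset.powersetCard 1 (Finset.range 3),
          ∀ m ∈ Finset.powersetCard 2 (Finset.range 3),
          l.sum id + m.sum id = 2 ∧ ¬(0 ∈ l ∧ 0 ∈ m) → l = {1} ∧ m = {0, 1} := by decide
      obtain ⟨f1, f2⟩ := key _ e1 _ e2 e3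
      right; right
      rw [← hl, f1]
      exact ⟨rfl, f2⟩

lemma HasRankD.gap_of_excess_eq_two {q : ℚ} (hq : 2 ≤ q) (h : HasRankD n s 0 l m) (hM : M ∈ l)
    (hmax : ∀ y, y ∈ l ∨ y ∈ m → y ≤ M) (hk : (M : ℤ) + 1 + 2 = n + s)
    (hr : ¬(0 ∈ l ∧ 0 ∈ m)) : q ^ (4 * n) < q ^ 10 * gdegD q n l m := by
  have hs := h.excess_ge_of_reduced hM hk hr
  have hn := h.rows_nonneg hM
  have hl := Finset.insert_erase hM
  have hMl : ∀ y ∈ l.erase M, y < M := fun y hy => by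
    have := hmax y (Or.inl (Finset.mem_of_mem_erase hy))
    have := Finset.ne_of_mem_erase hy
    omega
  have hMm : ∀ y ∈ m, y ≤ M := fun y hy => hmax y (Or.inr hy)
  have hs3 : s ≤ 3 := by omega
  have hs1 : 1 ≤ s := by omega
  interval_cases s
  · obtain rfl : n = M + 2 := by omega
    obtain ⟨e1, e2, e3⟩ := h.rows_mem hM hk hr (c := 0) (d := 1) (e := 2) rfl rfl rfl
    have key : ∀ l ∈ Finset.powersetCard 0 (Finset.range 3),
        ∀ m ∈ Finset.powersetCard 1 (Finset.range 3),
        l.sum id + m.sum id = 2 ∧ ¬(0 ∈ l ∧ 0 ∈ m) → l = ∅ ∧ m = {2} := by decide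
    obtain ⟨f1, rfl⟩ := key _ e1 _ e2 e3
    rw [← hl, f1]
    exact gap_two_max hq (hMm 2 (by simp))
  · obtain rfl : n = M + 1 := by omega
    obtain ⟨e1, e2, e3⟩ := h.rows_mem hM hk hr (c := 1) (d := 2) (e := 3) rfl rfl rfl
    have key : ∀ l ∈ Finset.powersetCard 1 (Finset.range 4),
        ∀ m ∈ Finset.powersetCard 2 (Finset.range 4),
        l.sum id + m.sum id = 3 ∧ ¬(0 ∈ l ∧ 0 ∈ m) → (l = {2} ∧ m = {0, 1}) ∨
          (l = {1} ∧ m = {0, 2}) ∨ (l = {0} ∧ m = {1, 2}) := by decide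
    rw [← hl]
    obtain ⟨f1, rfl⟩ | ⟨f1, rfl⟩ | ⟨f1, rfl⟩ := key _ e1 _ e2 e3
    · rw [f1] at hMl ⊢
      exact gap_twoMax_zeroOne hq (hMl 2 (by simp))
    · rw [f1]
      exact gap_oneMax_zeroTwo hq (hMm 2 (by simp))
    · rw [f1]
      exact gap_zeroMax_oneTwo hq (hMm 2 (by simp))
  · obtain rfl : n = M := by omega
    obtain ⟨e1, e2, e3⟩ := h.rows_mem hM hk hr (c := 2) (d := 3) (e := 6) rfl rfl rfl
    have key : ∀ l ∈ Finset.powersetCard 2 (Finset.range 7),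
        ∀ m ∈ Finset.powersetCard 3 (Finset.range 7),
        l.sum id + m.sum id = 6 ∧ ¬(0 ∈ l ∧ 0 ∈ m) → l = {1, 2} ∧ m = {0, 1, 2} := by
      decide +kernel
    obtain ⟨f1, rfl⟩ := key _ e1 _ e2 e3
    rw [← hl]
    rw [f1] at hMl ⊢
    exact gap_oneTwoMax_zeroOneTwo hq (hMl 2 (by simp))

lemma HasRankD.eq_of_excess_eq_two (h : HasRankD n s 2 l m) (hM : M ∈ l)
    (hk : (M : ℤ) + 1 + 2 = n + s) (hr : ¬(0 ∈ l ∧ 0 ∈ m)) :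
    n = M + 1 ∧ l = {M, 0, 1, 2} ∧ m = ∅ := by
  have hs := h.excess_ge_of_reduced hM hk hr
  have hn := h.rows_nonneg hM
  have hl := Finset.insert_erase hM
  obtain rfl : s = 2 := by omega
  obtain ⟨e1, e2, e3⟩ := h.rows_mem hM hk hr (c := 3) (d := 0) (e := 3) rfl rfl rfl
  have key : ∀ l ∈ Finset.powersetCard 3 (Finset.range 4),
      ∀ m ∈ Finset.powersetCard 0 (Finset.range 4),
      l.sum id + m.sum id = 3 ∧ ¬(0 ∈ l ∧ 0 ∈ m) → l = {0, 1, 2} ∧ m = ∅ := by decide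
  obtain ⟨f1, f2⟩ := key _ e1 _ e2 e3
  rw [← hl, f1]
  exact ⟨by omega, rfl, f2⟩

lemma HasRankD.gap_of_excess_eq_three {q : ℚ} (hq : 2 ≤ q) (h : HasRankD n s 2 l m)
    (hM : M ∈ l) (hmax : ∀ y ∈ l, y ≤ M) (hk : (M : ℤ) + 1 + 3 = n + s)
    (hr : ¬(0 ∈ l ∧ 0 ∈ m)) : q ^ (4 * n) < q ^ 10 * gdegD q n l m := by
  have hs := h.excess_ge_of_reduced hM hk hr
  have hn := h.rows_nonneg hM
  have hl := Finset.insert_erase hM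
  have hMl : ∀ y ∈ l.erase M, y < M := fun y hy => by
    have := hmax y (Finset.mem_of_mem_erase hy)
    have := Finset.ne_of_mem_erase hy
    omega
  have hs3 : s ≤ 3 := by omega
  have hs1 : 2 ≤ s := by omega
  interval_cases s
  · obtain rfl : n = M + 2 := by omega
    obtain ⟨e1, e2, e3⟩ := h.rows_mem hM hk hr (c := 3) (d := 0) (e := 4) rfl rfl rfl
    have key : ∀ l ∈ Finset.powersetCard 3 (Finset.range 5),
        ∀ m ∈ Finset.powersetCard 0 (Finset.range 5),
        l.sum id + m.sum id = 4 ∧ ¬(0 ∈ l ∧ 0 ∈ m) → l = {0, 1, 3} ∧ m = ∅ := by decide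
    obtain ⟨f1, rfl⟩ := key _ e1 _ e2 e3
    rw [← hl]
    rw [f1] at hMl ⊢
    exact gap_zeroOneThreeMax_empty hq (hMl 3 (by simp))
  · obtain rfl : n = M + 1 := by omega
    obtain ⟨e1, e2, e3⟩ := h.rows_mem hM hk hr (c := 4) (d := 1) (e := 7) rfl rfl rfl
    have key : ∀ l ∈ Finset.powersetCard 4 (Finset.range 8),
        ∀ m ∈ Finset.powersetCard 1 (Finset.range 8),
        l.sum id + m.sum id = 7 ∧ ¬(0 ∈ l ∧ 0 ∈ m) → l = {0, 1, 2, 3} ∧ m = {1} := by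
      decide +kernel
    obtain ⟨f1, rfl⟩ := key _ e1 _ e2 e3
    rw [← hl]
    rw [f1] at hMl ⊢
    exact gap_zeroOneTwoThreeMax_one hq (hMl 3 (by simp))

end Excess

/-! ### Rows consisting of an initial interval -/

section Cuspidal

variable {q : ℚ}

lemma pow_sq_le_evenProd (hq : 2 ≤ q) (x : ℕ) : q ^ (x ^ 2) ≤ evenProd q x := by
  induction x with
  | zero => simp [evenProd_zero]
  | succ x ih =>
    have h1 : 1 ≤ q ^ (2 * x + 1) := one_le_pow₀ (by linarith)
    have h2 : q ^ (2 * x + 1) ≤ q ^ (2 * (x + 1)) - 1 := by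
      have e : q ^ (2 * (x + 1)) = q ^ (2 * x + 1) * q := by ring
      rw [e]
      nlinarith
    rw [evenProd_succ, show (x + 1) ^ 2 = x ^ 2 + (2 * x + 1) by ring, pow_add]
    exact mul_le_mul ih h2 (by positivity) (evenProd_pos hq x).le

lemma evenProd_le_pow (hq : 2 ≤ q) (x : ℕ) : evenProd q x ≤ q ^ (x * (x + 1)) := by
  induction x with
  | zero => simp [evenProd_zero]
  | succ x ih =>
    have h1 : 1 ≤ q ^ (2 * (x + 1)) := one_le_pow₀ (by linarith)
    rw [evenProd_succ, show (x + 1) * (x + 1 + 1) = x * (x + 1) + 2 * (x + 1) by ring, pow_add]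
    exact mul_le_mul ih (by linarith) (by linarith) (by positivity)

lemma prodDen_range_le (hq : 2 ≤ q) (c : ℕ) :
    prodDen q (Finset.range c) ≤ q ^ (c * (c - 1)) * prodDiff q (Finset.range c) := by
  induction c with
  | zero => simp [prodDen, prodDiff]
  | succ c ih =>
    have hd := prodDiff_pos hq (Finset.range c)
    have hq0 : 0 < q := by linarith
    have hprod : (q ^ (c - 1)) ^ c ≤ ∏ y ∈ Finset.range c, |q ^ c - q ^ y| := by
      calc (q ^ (c - 1)) ^ c = ∏ _y ∈ Finset.range c, q ^ (c - 1) := by simp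
        _ ≤ _ := by
          refine Finset.prod_le_prod (fun _ _ => by positivity) fun y hy => ?_
          have hy := Finset.mem_range.1 hy
          obtain ⟨c, rfl⟩ : ∃ d, c = d + 1 := ⟨c - 1, by omega⟩
          have h1 : q ^ y ≤ q ^ c := pow_le_pow_of_two_le hq (by omega)
          have h2 : 0 < q ^ c := by positivity
          refine le_trans ?_ (le_abs_self _)
          rw [Nat.add_sub_cancel, pow_succ]
          nlinarith
    have he : evenProd q c ≤ q ^ (2 * c) * ∏ y ∈ Finset.range c, |q ^ c - q ^ y| := by
      refine (evenProd_le_pow hq c).trans ?_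
      calc q ^ (c * (c + 1)) = q ^ (2 * c) * (q ^ (c - 1)) ^ c := by
            rw [← pow_mul, ← pow_add]
            congr 1
            cases c with
            | zero => rfl
            | succ c => rw [Nat.add_sub_cancel]; ring
        _ ≤ _ := by gcongr
    rw [Finset.range_add_one, prodDen_insert q Finset.notMem_range_self,
      prodDiff_insert hq Finset.notMem_range_self]
    calc _ ≤ (q ^ (2 * c) * ∏ y ∈ Finset.range c, |q ^ c - q ^ y|) *
          (q ^ (c * (c - 1)) * prodDiff q (Finset.range c)) :=
          mul_le_mul he ih (prodDen_pos hq _).le (by positivity)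
      _ = q ^ (2 * c + c * (c - 1)) * ((∏ y ∈ Finset.range c, |q ^ c - q ^ y|) *
          prodDiff q (Finset.range c)) := by rw [pow_add]; ring
      _ = _ := by
        congr 2
        cases c with
        | zero => rfl
        | succ c => simp only [Nat.add_sub_cancel]; ring

lemma symbN_self_le (u : ℕ) : symbN u u ≤ u ^ 3 := by
  induction u with
  | zero => simp [symbN]
  | succ u ih =>
    have h : (u + u).choose 2 ≤ 3 * u ^ 2 + 3 * u + 1 := by
      rw [Nat.choose_two_right]
      refine Nat.div_le_of_le_mul ?_
      calc (u + u) * (u + u - 1) ≤ (u + u) * (u + u) := Nat.mul_le_mul_left _ (Nat.sub_le _ _)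
        _ ≤ _ := by nlinarith
    rw [symbN_succ_succ]
    calc _ ≤ 3 * u ^ 2 + 3 * u + 1 + u ^ 3 := by omega
      _ = _ := by ring

lemma gap_range_empty (hq : 2 ≤ q) {u : ℕ} (hu : 4 ≤ u) :
    q ^ (4 * u ^ 2) < q ^ 10 * gdegD q (u ^ 2) (Finset.range (2 * u)) ∅ := by
  have hq0 : 0 < q := by linarith
  have hN : symbN (2 * u) 0 ≤ u ^ 3 := by
    have : symbN (2 * u) 0 = symbN u u := by
      unfold symbN
      rw [add_zero, two_mul]
    exact this ▸ symbN_self_le u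
  have hE := pow_sq_le_evenProd hq (u ^ 2 - 1)
  have hD := prodDen_range_le hq (2 * u)
  have hdiff := prodDiff_pos hq (Finset.range (2 * u))
  have hden := prodDen_pos hq (Finset.range (2 * u))
  have hne : Finset.range (2 * u) ≠ ∅ := by simp; omega
  have hfirst : q ^ (u ^ 2 - 1) ≤ q ^ (u ^ 2) - 1 := by
    have h1 : 1 ≤ q ^ (u ^ 2 - 1) := one_le_pow₀ (by linarith)
    have h2 : q ^ (u ^ 2) = q ^ (u ^ 2 - 1) * q := by
      rw [← pow_succ, Nat.sub_add_cancel (by nlinarith)]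
    nlinarith
  have hd : gdegD q (u ^ 2) (Finset.range (2 * u)) ∅ =
      (q ^ (u ^ 2) - 1) * evenProd q (u ^ 2 - 1) * prodDiff q (Finset.range (2 * u)) /
        (2 ^ (u - 1) * q ^ symbN (2 * u) 0 * prodDen q (Finset.range (2 * u))) := by
    rw [gdegD, if_neg hne, evenProd]
    simp [prodDiff, prodSum, prodDen, show (2 * u - 2) / 2 = u - 1 by omega]
  rw [hd, ← mul_div_assoc, lt_div_iff₀ (by positivity)]
  have hexp : 4 * u ^ 2 + ((u - 1) + u ^ 3 + 2 * u * (2 * u - 1)) <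
      10 + ((u ^ 2 - 1) + (u ^ 2 - 1) ^ 2) := by
    obtain ⟨w, rfl⟩ : ∃ w, u = w + 4 := ⟨u - 4, by omega⟩
    rw [show (w + 4) ^ 2 - 1 = w ^ 2 + 8 * w + 15 by
        rw [show (w + 4) ^ 2 = w ^ 2 + 8 * w + 15 + 1 by ring, Nat.add_sub_cancel],
      show w + 4 - 1 = w + 3 by omega, show 2 * (w + 4) - 1 = 2 * w + 7 by omega]
    nlinarith [sq_nonneg w]
  calc q ^ (4 * u ^ 2) * (2 ^ (u - 1) * q ^ symbN (2 * u) 0 * prodDen q (Finset.range (2 * u)))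
      ≤ q ^ (4 * u ^ 2) * (q ^ (u - 1) * q ^ (u ^ 3) *
          (q ^ (2 * u * (2 * u - 1)) * prodDiff q (Finset.range (2 * u)))) := by
        gcongr
        linarith
    _ = q ^ (4 * u ^ 2 + ((u - 1) + u ^ 3 + 2 * u * (2 * u - 1))) *
          prodDiff q (Finset.range (2 * u)) := by simp only [pow_add]; ring
    _ < q ^ (10 + ((u ^ 2 - 1) + (u ^ 2 - 1) ^ 2)) * prodDiff q (Finset.range (2 * u)) := by
        gcongr
        linarith
    _ = q ^ 10 * (q ^ (u ^ 2 - 1) * q ^ ((u ^ 2 - 1) ^ 2) * prodDiff q (Finset.range (2 * u))) := by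
        rw [pow_add, pow_add]; ring
    _ ≤ _ := by
        have : 0 ≤ q ^ (u ^ 2) - 1 := le_trans (by positivity) hfirst
        gcongr

end Cuspidal

/-! ### The induction on the rank -/

/-- The lower bound for the generic degrees of all symbols of rank `n` whose entries are not
too large. -/
def GapBound (q : ℚ) (n : ℕ) : Prop :=
  ∀ (s u : ℤ) (l m : Finset ℕ), HasRankD n s u l m →
    (∀ y, y ∈ l ∨ y ∈ m → (y : ℤ) + (if |u| = 2 then 4 else 3) ≤ n + s) →
    q ^ (4 * n) < q ^ 10 * gdegD q n l m

lemma gap_succ_of_le {q : ℚ} (hq : 2 ≤ q) {n : ℕ} {l m l' m' : Finset ℕ}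
    (h : q ^ (4 * n) < q ^ 10 * gdegD q n l' m')
    (hle : q ^ 4 * gdegD q n l' m' ≤ gdegD q (n + 1) l m) :
    q ^ (4 * (n + 1)) < q ^ 10 * gdegD q (n + 1) l m := by
  have hq0 : 0 < q := by linarith
  calc q ^ (4 * (n + 1)) = q ^ 4 * q ^ (4 * n) := by ring
    _ < q ^ 4 * (q ^ 10 * gdegD q n l' m') := by gcongr
    _ = q ^ 10 * (q ^ 4 * gdegD q n l' m') := by ring
    _ ≤ _ := by gcongr

section Step

variable {q : ℚ} {n M : ℕ} {s u : ℤ} {l m : Finset ℕ}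

lemma GapBound.gap_succ (hq : 2 ≤ q) (ih : GapBound q n) (h : HasRankD (n + 1) s u l m)
    (hmax : ∀ y, y ∈ l ∨ y ∈ m → y ≤ M)
    (hK : (M : ℤ) + (if |u| = 2 then 4 else 3) ≤ n + s) {x : ℕ} (hx : x ∉ l) (hx1 : x + 1 ∈ l)
    (hle : q ^ 4 * gdegD q n (insert x (l.erase (x + 1))) m ≤ gdegD q (n + 1) l m) :
    q ^ (4 * (n + 1)) < q ^ 10 * gdegD q (n + 1) l m := by
  refine gap_succ_of_le hq (ih s u _ _ (h.decrease hx hx1) fun y hy => ?_) hle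
  have : y ≤ M := by
    rcases hy with hy | hy
    · rcases Finset.mem_insert.1 hy with rfl | hy
      · have := hmax _ (Or.inl hx1)
        omega
      · exact hmax _ (Or.inl (Finset.mem_of_mem_erase hy))
    · exact hmax _ (Or.inr hy)
  omega

lemma gap_of_eq_rows (hq : 2 ≤ q) (h : HasRankD n s 0 l l) (hM : M ∈ l)
    (hk : (M : ℤ) + 1 + 3 = n + s) (h0 : 0 ∉ l) : q ^ (4 * n) < q ^ 10 * gdegD q n l l := by
  have h1 := h.excess_ge hM hk (i := 1) (j := 1) (one_le_of_zero_notMem h0)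
    (one_le_of_zero_notMem h0)
  have hn := h.rows_nonneg hM
  have hl := Finset.insert_erase hM
  have hs2 : s ≤ 2 := by push_cast at h1; omega
  have hs1 : 1 ≤ s := by omega
  interval_cases s
  · obtain ⟨e1, e2, e3⟩ := h.rows_mem hM hk (by simp [h0]) (c := 0) (d := 1) (e := 3) rfl rfl rfl
    have key : ∀ l ∈ Finset.powersetCard 0 (Finset.range 4),
        ∀ m ∈ Finset.powersetCard 1 (Finset.range 4),
        l.sum id + m.sum id = 3 ∧ ¬(0 ∈ l ∧ 0 ∈ m) → m = {3} := by decide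
    obtain rfl := key _ e1 _ e2 e3
    obtain rfl : M = 3 := by simpa using hM
    obtain rfl : n = 6 := by omega
    exact gap_three_three hq
  · obtain ⟨e1, e2, e3⟩ := h.rows_mem hM hk (by simp [h0]) (c := 1) (d := 2) (e := 4) rfl rfl rfl
    have key : ∀ l ∈ Finset.powersetCard 1 (Finset.range 5),
        ∀ m ∈ Finset.powersetCard 2 (Finset.range 5),
        l.sum id + m.sum id = 4 ∧ ¬(0 ∈ l ∧ 0 ∈ m) → l ⊆ m → 0 ∉ m → l = {1} ∧ m = {1, 2} := by
      decide
    obtain ⟨f1, rfl⟩ := key _ e1 _ e2 e3 (Finset.erase_subset _ _) h0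
    obtain rfl : M = 2 := by
      rcases Finset.mem_insert.1 hM with rfl | hM
      · exact absurd f1 (by decide)
      · simpa using hM
    obtain rfl : n = 4 := by omega
    exact gap_oneTwo_oneTwo hq

lemma HasRankD.eq_of_top_two (h : HasRankD n s 0 l m) {N : ℕ} (hl : N + 1 ∈ l) (hl' : N ∈ l)
    (hm : N + 1 ∈ m) (hm' : N ∈ m) (hmax : ∀ y, y ∈ l ∨ y ∈ m → y ≤ N + 1)
    (hk : (N : ℤ) + 5 = n + s) (hr : ¬(0 ∈ l ∧ 0 ∈ m)) : l = m := by
  have hle : N ∈ l.erase (N + 1) := Finset.mem_erase.2 ⟨by omega, hl'⟩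
  have hme : N ∈ m.erase (N + 1) := Finset.mem_erase.2 ⟨by omega, hm'⟩
  have bound : ∀ t : Finset ℕ, N + 1 ∈ t → N ∈ t.erase (N + 1) → ∀ i : ℕ, (∀ y ∈ t, i ≤ y) →
      ((t.card : ℤ) - 2) * (t.card - 3) + 2 * i * (t.card - 2) ≤
        2 * (((t.sum id : ℕ) : ℤ) - (2 * N + 1)) := by
    intro t h1 h2 i hi
    have := card_mul_le_two_mul_sum ((t.erase (N + 1)).erase N) (j := i)
      fun y hy => hi y (Finset.mem_of_mem_erase (Finset.mem_of_mem_erase hy))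
    rw [card_erase_cast h2, card_erase_cast h1, sum_erase_id h2, sum_erase_id h1] at this
    push_cast at *
    linarith
  have hcl := h.card_left
  have hcm := h.card_right
  have hsum := h.sum_eq
  have h1 : 1 < l.card := Finset.one_lt_card.2 ⟨N, hl', N + 1, hl, by omega⟩
  have main : 3 * (N : ℤ) ≤ 2 * s - 1 ∧ s ≤ N + 1 := by
    by_cases h0 : 0 ∈ l
    · have hm1 := one_le_of_zero_notMem fun hm => hr ⟨h0, hm⟩
      have b1 := bound l hl hle 0 (by simp)
      have b2 := bound m hm hme 1 hm1
      have b3 := card_add_le_of_forall_mem hm1 (fun y hy => hmax y (Or.inr hy)) ⟨_, hm⟩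
      rw [hcl] at b1
      rw [hcm] at b2
      simp only [Nat.cast_zero, Nat.cast_one] at b1 b2
      constructor
      · nlinarith
      · omega
    · have hl1 := one_le_of_zero_notMem h0
      have b1 := bound l hl hle 1 hl1
      have b2 := bound m hm hme 0 (by simp)
      have b3 := card_add_le_of_forall_mem hl1 (fun y hy => hmax y (Or.inl hy)) ⟨_, hl⟩
      rw [hcl] at b1
      rw [hcm] at b2
      simp only [Nat.cast_zero, Nat.cast_one] at b1 b2
      constructor
      · nlinarith
      · omega
  have hpair : ∀ t : Finset ℕ, N ∈ t → N + 1 ∈ t → t.card = 2 → {N, N + 1} = t := by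
    intro t ht1 ht2 hc
    refine Finset.eq_of_subset_of_card_le (fun y hy => ?_) ?_
    · rcases Finset.mem_insert.1 hy with rfl | hy
      · exact ht1
      · rwa [Finset.mem_singleton.1 hy]
    · rw [hc, Finset.card_pair (by omega)]
  rw [← hpair l hl' hl (by omega), ← hpair m hm' hm (by omega)]

lemma GapBound.gap_of_run (hq : 2 ≤ q) (hn : 1 ≤ n) (ih : GapBound q n)
    (h : HasRankD (n + 1) s u l m) (hM : M ∈ l) (hmax : ∀ y, y ∈ l ∨ y ∈ m → y ≤ M)
    (hK : (M : ℤ) + (if |u| = 2 then 4 else 3) ≤ n + s) (hr : ¬(0 ∈ l ∧ 0 ∈ m)) {x : ℕ}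
    (hx : x ∉ l) (hxM : x + 1 ≤ M) (hrun : ∀ y, x + 1 ≤ y → y ≤ M → y ∈ l) :
    q ^ (4 * (n + 1)) < q ^ 10 * gdegD q (n + 1) l m := by
  by_cases hexp : 2 * x + 5 + (if x + 1 = M then 1 else 2) + (if l = m then 1 else 0) + (M - x) ≤
      2 * n + l.card + (m.filter (· ≤ x)).card
  · exact ih.gap_succ hq h hmax hK hx (hrun _ le_rfl hxM)
      (gdegD_decrease_run hq hn hx hxM (fun y hy => hmax y (Or.inl hy)) hrun hexp)
  have hsub : m.filter (fun y => ¬ y ≤ x) ⊆ Finset.Icc (x + 1) M := fun y hy => by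
    obtain ⟨h1, h2⟩ := Finset.mem_filter.1 hy
    exact Finset.mem_Icc.2 ⟨by omega, hmax y (Or.inr h1)⟩
  have ht := Finset.card_le_card hsub
  have hsplit := Finset.card_filter_add_card_filter_not (s := m) (· ≤ x)
  rw [Nat.card_Icc] at ht
  have hcl := h.card_left
  have hcm := h.card_right
  obtain ⟨k, hk⟩ : ∃ k : ℤ, (M : ℤ) + 1 + k = (n + 1 : ℕ) + s := ⟨_, add_sub_cancel _ _⟩
  push_cast at hk
  have hk3 : k = 3 := by
    split_ifs at hK hexp <;> omega
  subst hk3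
  obtain rfl : u = 0 := by
    rcases h.defect_eq_zero_or_two hM (k := 3) (by push_cast; exact hk) (by norm_num) with h0 | h2
    · exact h0
    · rw [h2] at hK
      norm_num at hK
      omega
  by_cases hlm : l = m
  · subst hlm
    exact gap_of_eq_rows hq h hM (by push_cast; exact hk) fun h0 => hr ⟨h0, h0⟩
  · exfalso
    rw [if_neg hlm] at hexp
    have ht2 : x + 2 ≤ M ∧ M + 1 - (x + 1) ≤ (m.filter (fun y => ¬ y ≤ x)).card := by
      split_ifs at hK hexp <;> omega
    have heq := Finset.eq_of_subset_of_card_le hsub (by rw [Nat.card_Icc]; exact ht2.2)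
    have hmem : ∀ y, x + 1 ≤ y → y ≤ M → y ∈ m := fun y h1 h2 =>
      Finset.mem_of_mem_filter y (heq ▸ Finset.mem_Icc.2 ⟨h1, h2⟩)
    obtain ⟨N, rfl⟩ : ∃ N, M = N + 1 := ⟨M - 1, by omega⟩
    exact hlm (h.eq_of_top_two hM (hrun N (by omega) (by omega)) (hmem _ (by omega) le_rfl)
      (hmem N (by omega) (by omega)) hmax (by push_cast at hk ⊢; linarith) hr)

lemma GapBound.gap_of_range (hq : 2 ≤ q) (hn : 1 ≤ n) (ih : GapBound q n)
    (h : HasRankD (n + 1) s u (Finset.range (M + 1)) m) (hMm : M ∉ m) (hmax : ∀ y ∈ m, y ≤ M)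
    (hK : (M : ℤ) + (if |u| = 2 then 4 else 3) ≤ n + s) (h0 : 0 ∉ m) :
    q ^ (4 * (n + 1)) < q ^ 10 * gdegD q (n + 1) (Finset.range (M + 1)) m := by
  have hcl := h.card_left
  have hcm := h.card_right
  rw [Finset.card_range] at hcl
  push_cast at hcl
  obtain ⟨v, hv⟩ := h.even
  rcases m.eq_empty_or_nonempty with rfl | hne
  · rw [Finset.card_empty] at hcm
    have hsu : s = u := by push_cast at hcm; linarith
    subst hsu
    have hsum := h.sum_eq
    have hgauss := Finset.sum_range_id_mul_two (M + 1)
    zify at hgauss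
    simp only [Finset.sum_empty, Nat.cast_zero, add_zero, id, Nat.add_sub_cancel] at hsum hgauss
    push_cast at hsum hgauss
    have hn1 : (n : ℤ) + 1 = s ^ 2 := by nlinarith
    have hs4 : 4 ≤ s := by
      have : 1 ≤ s := by omega
      by_contra hlt
      obtain rfl : s = 2 := by omega
      norm_num at hK
      omega
    lift s to ℕ using by omega
    have e1 : M + 1 = 2 * s := by omega
    have e2 : n + 1 = s ^ 2 := by exact_mod_cast hn1
    rw [e1, e2]
    exact gap_range_empty hq (by omega)
  · have hM'm := m.max'_mem hne
    have hM'max : ∀ y ∈ m, y ≤ m.max' hne := fun y hy => m.le_max' y hy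
    have hM'lt : m.max' hne < M := lt_of_le_of_ne (hmax _ hM'm) fun e => hMm (e ▸ hM'm)
    have hm1 := one_le_of_zero_notMem h0
    have hb := card_add_le_of_forall_mem hm1 hM'max hne
    have hex := h.excess_ge (M := M) (k := n + 1 + s - M - 1) (i := 0) (j := 1) (by simp)
      (by push_cast; ring) (by simp) hm1
    push_cast at hex
    generalize m.max' hne = M' at *
    rcases exists_run hM'm hM'max with ⟨x, hx, hxM, hrun⟩ | hrange
    · have hfil : (Finset.range (M + 1)).filter (· ≤ x) = Finset.range (x + 1) := by
        ext y
        simp only [Finset.mem_filter, Finset.mem_range]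
        omega
      have hne' : m ≠ Finset.range (M + 1) := fun e => hMm (e ▸ by simp)
      have hu : 2 ≤ u := by omega
      have hsq : 2 * u ≤ u ^ 2 := by nlinarith
      rw [gdegD_comm]
      refine ih.gap_succ hq h.symm (M := M) (fun y hy => ?_) (by rwa [abs_neg]) hx
        (hrun _ le_rfl hxM) (gdegD_decrease_run hq hn hx hxM hM'max hrun ?_)
      · rcases hy with hy | hy
        · exact hmax y hy
        · have := Finset.mem_range.1 hy
          omega
      · rw [hfil, Finset.card_range, if_neg hne']
        have : 1 ≤ m.card := Finset.card_pos.2 hne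
        split_ifs <;> omega
    · exact absurd (hrange ▸ by simp) h0

lemma GapBound.gap_of_max_mem (hq : 2 ≤ q) (hn : 1 ≤ n) (ih : GapBound q n)
    (h : HasRankD (n + 1) s u l m) (hM : M ∈ l) (hmax : ∀ y, y ∈ l ∨ y ∈ m → y ≤ M)
    (hK : (M : ℤ) + (if |u| = 2 then 4 else 3) ≤ n + s) (hr : ¬(0 ∈ l ∧ 0 ∈ m)) :
    q ^ (4 * (n + 1)) < q ^ 10 * gdegD q (n + 1) l m := by
  rcases exists_run hM fun y hy => hmax y (Or.inl hy) with ⟨x, hx, hxM, hrun⟩ | hrange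
  · exact ih.gap_of_run hq hn h hM hmax hK hr hx hxM hrun
  · have h0 : 0 ∉ m := fun h0 => hr ⟨hrange ▸ by simp, h0⟩
    by_cases hMm : M ∈ m
    · rcases exists_run hMm fun y hy => hmax y (Or.inr hy) with ⟨x, hx, hxM, hrun⟩ | hrange'
      · rw [gdegD_comm]
        exact ih.gap_of_run hq hn h.symm hMm (fun y hy => hmax y hy.symm) (by rwa [abs_neg])
          (fun h' => hr h'.symm) hx hxM hrun
      · exact absurd (hrange' ▸ by simp) h0
    · subst hrange
      exact ih.gap_of_range hq hn h hMm (fun y hy => hmax y (Or.inr hy)) hK h0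

lemma HasRankD.exists_max (hn : 1 ≤ n) (h : HasRankD n s u l m) :
    ∃ M, (M ∈ l ∨ M ∈ m) ∧ ∀ y, y ∈ l ∨ y ∈ m → y ≤ M := by
  have hne : (l ∪ m).Nonempty := by
    rw [Finset.nonempty_iff_ne_empty]
    intro he
    obtain ⟨rfl, rfl⟩ := Finset.union_eq_empty.1 he
    have h1 := h.card_left
    have h2 := h.card_right
    have h3 := h.sum_eq
    simp only [Finset.card_empty, Finset.sum_empty, Nat.cast_zero] at h1 h2 h3
    have : s = 0 := by omega
    subst this
    norm_num at h3
    omega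
  exact ⟨(l ∪ m).max' hne, Finset.mem_union.1 ((l ∪ m).max'_mem hne),
    fun y hy => (l ∪ m).le_max' y (Finset.mem_union.2 hy)⟩

lemma GapBound.gap_of_reduced (hq : 2 ≤ q) (ih : 1 ≤ n → GapBound q n)
    (h : HasRankD (n + 1) s u l m) (hM : M ∈ l) (hmax : ∀ y, y ∈ l ∨ y ∈ m → y ≤ M)
    (hK : (M : ℤ) + (if |u| = 2 then 4 else 3) ≤ n + 1 + s) (hr : ¬(0 ∈ l ∧ 0 ∈ m)) :
    q ^ (4 * (n + 1)) < q ^ 10 * gdegD q (n + 1) l m := by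
  by_cases hK' : (M : ℤ) + (if |u| = 2 then 4 else 3) ≤ n + s
  · have b1 := card_add_le_of_forall_mem (j := 0) (by simp) (fun y hy => hmax y (Or.inl hy)) ⟨_, hM⟩
    have b2 : m.card ≤ M + 1 := by
      rcases m.eq_empty_or_nonempty with rfl | hne
      · simp
      · exact card_add_le_of_forall_mem (j := 0) (by simp) (fun y hy => hmax y (Or.inr hy)) hne
    have h1 := h.card_left
    have h2 := h.card_right
    have hn : 1 ≤ n := by split_ifs at hK' <;> omega
    exact (ih hn).gap_of_max_mem hq hn h hM hmax hK' hr
  · by_cases hu : |u| = 2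
    · rw [if_pos hu] at hK hK'
      have hk : (M : ℤ) + 1 + 3 = (n + 1 : ℕ) + s := by push_cast; omega
      have hu2 : u = 2 := by
        rcases h.defect_eq_zero_or_two hM hk (by norm_num) with rfl | h2
        · simp at hu
        · exact h2
      subst hu2
      exact h.gap_of_excess_eq_three hq hM (fun y hy => hmax y (Or.inl hy)) hk hr
    · rw [if_neg hu] at hK hK'
      have hk : (M : ℤ) + 1 + 2 = (n + 1 : ℕ) + s := by push_cast; omega
      have hu0 : u = 0 := by
        rcases h.defect_eq_zero_or_two hM hk (by norm_num) with h0 | rfl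
        · exact h0
        · simp at hu
      subst hu0
      exact h.gap_of_excess_eq_two hq hM hmax hk hr

end Step

theorem gapBound {q : ℚ} (hq : 2 ≤ q) {n : ℕ} (hn : 1 ≤ n) : GapBound q n := by
  induction n with
  | zero => omega
  | succ n ih =>
    intro s u l m h hK
    obtain ⟨s', l', m', h', hr, hK', e⟩ := h.exists_reduced hq hn _ hK
    rw [e]
    obtain ⟨M, hM, hmax⟩ := h'.exists_max hn
    have hKM := hK' M hM
    push_cast at hKM
    rcases hM with hM | hM
    · exact GapBound.gap_of_reduced hq ih h' hM hmax hKM hr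
    · rw [gdegD_comm]
      exact GapBound.gap_of_reduced hq ih h'.symm hM (fun y hy => hmax y hy.symm)
        (by rwa [abs_neg]) fun h0 => hr h0.symm

/-! ### The degree gap -/

lemma IsSymbolD.exists_hasRankD {n : ℕ} (hn : 1 ≤ n) {l m : Finset ℕ} (h : IsSymbolD n l m) :
    ∃ s u, HasRankD n s u l m := by
  obtain ⟨⟨v, hv⟩, -, hsum⟩ := h
  have hpos : 1 ≤ l.card + m.card := by
    by_contra! h0
    have hl : l = ∅ := Finset.card_eq_zero.1 (by omega)
    have hm : m = ∅ := Finset.card_eq_zero.1 (by omega)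
    subst hl hm
    simp at hsum
    omega
  obtain ⟨r, hr⟩ : ∃ r : ℕ, l.card + m.card = 2 * (r + 1) :=
    ⟨(l.card + m.card) / 2 - 1, by omega⟩
  have hsq : (l.card + m.card - 1) ^ 2 / 4 = r * (r + 1) := by
    rw [hr, show 2 * (r + 1) - 1 = 2 * r + 1 by omega,
      show (2 * r + 1) ^ 2 = 1 + 4 * (r * (r + 1)) by ring]
    omega
  refine ⟨r + 1, 2 * v, by omega, by omega, even_two_mul v, ?_⟩
  rw [hsq] at hsum
  have := congrArg (Nat.cast : ℕ → ℤ) hsum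
  rw [Nat.cast_add, Nat.cast_add, Nat.cast_mul] at this
  rw [this]
  push_cast
  ring

lemma HasRankD.gap_of_mem_left {q : ℚ} (hq : 2 ≤ q) {n : ℕ} (hn : 5 ≤ n) {s u : ℤ}
    {l m : Finset ℕ} (h : HasRankD n s u l m) (hr : ¬(0 ∈ l ∧ 0 ∈ m)) {M : ℕ} (hM : M ∈ l)
    (hmax : ∀ y, y ∈ l ∨ y ∈ m → y ≤ M) :
    (l = {n} ∧ m = {0}) ∨ (l = {n - 1} ∧ m = {1}) ∨ (l = {n, 1} ∧ m = {0, 1}) ∨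
      (n = 5 ∧ q < 3 ∧ l = {0, 1, 2, 4} ∧ m = ∅) ∨ q ^ (4 * n) < q ^ 10 * gdegD q n l m := by
  obtain ⟨k, hk⟩ : ∃ k : ℤ, (M : ℤ) + 1 + k = n + s := ⟨n + s - 1 - M, by ring⟩
  have hu := h.excess_ge_sq hM hk
  rcases le_or_gt k 1 with hk1 | hk1
  · obtain rfl : u = 0 := (h.defect_eq_zero_or_two hM hk (by omega)).resolve_right
      fun h2 => by subst h2; omega
    rcases h.eq_of_excess_le_one hM hk hr hk1 with h | h | h <;> simp [h]
  · by_cases hb : k = 2 ∧ |u| = 2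
    · obtain ⟨rfl, hu2⟩ := hb
      obtain rfl : u = 2 := (h.defect_eq_zero_or_two hM hk (by omega)).resolve_left
        fun h0 => by simp [h0] at hu2
      obtain ⟨rfl, rfl, rfl⟩ := h.eq_of_excess_eq_two hM hk hr
      by_cases h4 : M = 4 ∧ q < 3
      · obtain ⟨rfl, h3⟩ := h4
        exact Or.inr <| Or.inr <| Or.inr <| Or.inl ⟨rfl, h3, by decide, rfl⟩
      · refine Or.inr <| Or.inr <| Or.inr <| Or.inr <| gap_zeroOneTwoMax_empty hq ?_
        by_cases hM4 : M = 4
        · exact Or.inr ⟨hM4, not_lt.1 fun h3 => h4 ⟨hM4, h3⟩⟩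
        · omega
    · refine Or.inr <| Or.inr <| Or.inr <| Or.inr <| gapBound hq (by omega) s u l m h ?_
      intro y hy
      have := hmax y hy
      split_ifs with h2
      · have : k ≠ 2 := fun hk2 => hb ⟨hk2, h2⟩
        omega
      · omega

/-- A symbol of rank `n ≥ 5` and type `D_n` of generic degree at most `q ^ (4 * n - 10)` is one of
the listed ones. -/
theorem IsSymbolD.gap {q : ℚ} (hq : 2 ≤ q) {n : ℕ} (hn : 5 ≤ n) {l m : Finset ℕ}
    (h : IsSymbolD n l m)
    (hlist : (l, m) ∉ ([(({n} : Finset ℕ), ({0} : Finset ℕ)), ({0}, {n}), ({n - 1}, {1}),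
      ({1}, {n - 1}), ({0, 1}, {1, n}), ({1, n}, {0, 1})] : List (Finset ℕ × Finset ℕ)))
    (hexc : n = 5 → q < 3 → ¬(l = {0, 1, 2, 4} ∧ m = ∅) ∧ ¬(l = ∅ ∧ m = {0, 1, 2, 4})) :
    q ^ (4 * n - 10) < gdegD q n l m := by
  obtain ⟨s, u, hs⟩ := h.exists_hasRankD (by omega)
  have hr := h.2.1
  suffices hgap : q ^ (4 * n) < q ^ 10 * gdegD q n l m by
    rw [show 4 * n = 10 + (4 * n - 10) by omega, pow_add] at hgap
    exact lt_of_mul_lt_mul_left hgap (by positivity)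
  obtain ⟨M, hM | hM, hmax⟩ := hs.exists_max (by omega)
  · rcases hs.gap_of_mem_left hq hn hr hM hmax with ⟨rfl, rfl⟩ | ⟨rfl, rfl⟩ | ⟨rfl, rfl⟩ |
      ⟨h5, h3, e⟩ | hgap
    · simp at hlist
    · simp at hlist
    · simp [Finset.pair_comm n 1] at hlist
    · exact absurd e (hexc h5 h3).1
    · exact hgap
  · rw [gdegD_comm]
    rcases hs.symm.gap_of_mem_left hq hn (fun h0 => hr h0.symm) hM (fun y hy => hmax y hy.symm)
      with ⟨rfl, rfl⟩ | ⟨rfl, rfl⟩ | ⟨rfl, rfl⟩ | ⟨h5, h3, e⟩ | hgap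
    · simp at hlist
    · simp at hlist
    · simp [Finset.pair_comm n 1] at hlist
    · exact absurd e.symm (hexc h5 h3).2
    · exact hgap

/-- Proposition 3.4: for `q` a prime power and `n ≥ 5`, (a) if `(n,q) ≠ (5,2)`, every symbol
of rank `n` and type `D_n` other than the unordered symbols `(n),(0)`, `(n-1),(1)`,
`(0,1),(1,n)` — whose generic degrees are `1`, `(q^n-1)(q^(n-1)+q)/(q^2-1)`,
`(q^(2n)-q^2)/(q^2-1)` respectively — has generic degree greater than `q^(4n-10)`; (b) if
`(n,q) = (5,2)`, the same holds with the additional exception of the symbol `((0,1,2,4); )`,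
of generic degree `868 < 2^10`.  Consequently (via Lusztig's classification), the same holds
for the unipotent complex characters of `P(CO⁺_(2n)(q)⁰)`. -/
theorem symbolD_generic_degree_gap (q n : ℕ)
    (hq : ∃ p k : ℕ, p.Prime ∧ 0 < k ∧ q = p ^ k) (hn : 5 ≤ n) :
    (¬(n = 5 ∧ q = 2) →
      gdegD (q : ℚ) n {n} {0} = 1 ∧
      gdegD (q : ℚ) n {n - 1} {1} =
        ((q : ℚ) ^ n - 1) * ((q : ℚ) ^ (n - 1) + q) / ((q : ℚ) ^ 2 - 1) ∧
      gdegD (q : ℚ) n {0, 1} {1, n} =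
        ((q : ℚ) ^ (2 * n) - (q : ℚ) ^ 2) / ((q : ℚ) ^ 2 - 1) ∧
      ∀ l m : Finset ℕ, IsSymbolD n l m →
        (l, m) ∉ ([(({n} : Finset ℕ), ({0} : Finset ℕ)), ({0}, {n}), ({n - 1}, {1}), ({1}, {n - 1}),
        ({0, 1}, {1, n}), ({1, n}, {0, 1})] : List (Finset ℕ × Finset ℕ)) →
        (q : ℚ) ^ (4 * n - 10) < gdegD (q : ℚ) n l m) ∧
    (n = 5 ∧ q = 2 →
      gdegD (2 : ℚ) 5 {0, 1, 2, 4} ∅ = 868 ∧ (868 : ℚ) < 2 ^ 10 ∧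
      ∀ l m : Finset ℕ, IsSymbolD 5 l m →
        (l, m) ∉ ([(({5} : Finset ℕ), ({0} : Finset ℕ)), ({0}, {5}), ({4}, {1}), ({1}, {4}),
        ({0, 1}, {1, 5}), ({1, 5}, {0, 1}), ({0, 1, 2, 4}, ∅), (∅, {0, 1, 2, 4})] : List (Finset ℕ × Finset ℕ)) →
        (2 : ℚ) ^ 10 < gdegD (2 : ℚ) 5 l m) := by
  obtain ⟨p, k, hp, hk, hpk⟩ := hq
  have hq2 : 2 ≤ q := hpk ▸ hp.two_le.trans (Nat.le_self_pow hk.ne' p)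
  refine ⟨fun hne => ?_, ?_⟩
  · have hqQ : (2 : ℚ) ≤ q := by exact_mod_cast hq2
    refine ⟨gdegD_trivial hqQ (by omega), gdegD_pred_one hqQ (by omega),
      gdegD_zeroOne_oneMax hqQ (by omega), fun l m h hlist => h.gap hqQ hn hlist ?_⟩
    intro h5 h3
    have : q < 3 := by exact_mod_cast h3
    omega
  · rintro -
    refine ⟨gdegD_two_zeroOneTwoFour, by norm_num, fun l m h hlist => ?_⟩
    simp only [List.mem_cons, Prod.mk.injEq, not_or] at hlist
    exact h.gap (n := 5) le_rfl le_rfl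
      (by simp only [List.mem_cons, Prod.mk.injEq, not_or]; tauto) fun _ _ => by tauto
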